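/- arXiv:2008.09362 — 5 statements merged into one kernel-verified Lean document; each statement's English description precedes it below -/
import Mathlib

section
/- Let n ≥ 1 and q > 1, and set α := 1 − 1/(n+q). If (ρ_k) is a sequence of probability measures on ℝⁿ converging weakly to a probability measure ρ and sup_k M_1(ρ_k) < +∞, where M_1(σ) := ∫|x|dσ(x), then F(ρ) ≤ liminf_{k→∞} F(ρ_k). -/
open MeasureTheory Topology Filter Set
open scoped ENNReal RealInnerProductSpace

noncomputable section

abbrev En (n : ℕ) : Type := EuclideanSpace ℝ (Fin n)

/-- The positive part of an extended real number, as an element of `ℝ≥0∞`. -/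
def posPartNN (x : EReal) : ℝ≥0∞ := if x = ⊤ then ⊤ else ENNReal.ofReal x.toReal

/-- The integral of an `EReal`-valued function, with values in `EReal`
(defined as the integral of the positive part minus that of the negative part). -/
def eInt {X : Type*} [MeasurableSpace X] (ρ : Measure X) (g : X → EReal) : EReal :=
  ((∫⁻ x, posPartNN (g x) ∂ρ : ℝ≥0∞) : EReal) - ((∫⁻ x, posPartNN (-(g x)) ∂ρ : ℝ≥0∞) : EReal)

/-- Transport plans between `ρ` and `μ`. -/
def Plans {n : ℕ} (ρ μ : Measure (En n)) : Set (Measure (En n × En n)) :=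
  {γ | IsProbabilityMeasure γ ∧ γ.map Prod.fst = ρ ∧ γ.map Prod.snd = μ}

/-- The maximal correlation functional `T(ρ,μ)`. -/
def Tcorr {n : ℕ} (ρ μ : Measure (En n)) : EReal :=
  ⨆ γ ∈ Plans ρ μ, eInt γ (fun p => ((⟪p.1, p.2⟫ : ℝ) : EReal))

/-- The local functional `F(ρ) = ∫ f(ρ^ac) dx` with `f(t) = -t^α/α`, `α = 1 - 1/(n+q)`. -/
def Ffun (n : ℕ) (q : ℝ) (ρ : Measure (En n)) : EReal :=
  - ((∫⁻ x, ENNReal.ofReal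
      ((ρ.rnDeriv volume x).toReal ^ (1 - 1/((n : ℝ) + q)) / (1 - 1/((n : ℝ) + q)))
      ∂volume : ℝ≥0∞) : EReal)

/-- The functional `J(ρ) = F(ρ) + T(ρ,μ)`. -/
def Jfun (n : ℕ) (q : ℝ) (μ ρ : Measure (En n)) : EReal := Ffun n q ρ + Tcorr ρ μ

/-- Finite first moment. -/
def P1 {n : ℕ} (ρ : Measure (En n)) : Prop := Integrable (fun x : En n => ‖x‖) ρ

/-- `μ` is not supported on any affine hyperplane. -/
def NotHyperplane {n : ℕ} (μ : Measure (En n)) : Prop :=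
  ∀ (e : En n) (ℓ : ℝ), e ≠ 0 → μ {x | ⟪x, e⟫ = ℓ} ≠ 1


/-- The opposite of the local functional, as an extended nonnegative real number. -/
def powEnergy {n : ℕ} (p : ℝ) (σ : Measure (En n)) : ℝ≥0∞ :=
  ∫⁻ x, ENNReal.ofReal ((σ.rnDeriv volume x).toReal ^ (1 - 1/p) / (1 - 1/p))

/-- The integral of the dual density `v ↦ v^(1-p)/(p-1)`. -/
def dualEnergy {n : ℕ} (p : ℝ) (v : En n → ℝ) : ℝ≥0∞ :=
  ∫⁻ x, ENNReal.ofReal (v x ^ (1 - p) / (p - 1))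

lemma rpow_div_le_mul_add {p t v : ℝ} (hp : 1 < p) (ht : 0 ≤ t) (hv : 0 < v) :
    t ^ (1 - 1/p) / (1 - 1/p) ≤ v * t + v ^ (1 - p) / (p - 1) := by
  have hp0 : 0 < p := by linarith
  have hα : 0 < 1 - 1/p := by
    rw [sub_pos, div_lt_one hp0]; exact hp
  have h := Real.geom_mean_le_arith_mean2_weighted (w₁ := 1 - 1/p) (w₂ := 1/p)
    (p₁ := v * t) (p₂ := v ^ (1 - p)) hα.le (by positivity) (by positivity) (by positivity)
    (by ring)
  have e : (v * t) ^ (1 - 1/p) * (v ^ (1 - p)) ^ (1/p) = t ^ (1 - 1/p) := by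
    rw [Real.mul_rpow hv.le ht, ← Real.rpow_mul hv.le, mul_right_comm, ← Real.rpow_add hv]
    have : 1 - 1/p + (1 - p) * (1/p) = 0 := by field_simp; ring
    rw [this]; simp
  rw [e] at h
  rw [div_le_iff₀ hα]
  have hp1 : p - 1 ≠ 0 := by linarith
  have : (v * t + v ^ (1 - p) / (p - 1)) * (1 - 1/p)
      = (1 - 1/p) * (v * t) + 1/p * v ^ (1 - p) := by
    field_simp
  linarith

lemma rpow_dual_le_add_abs_sub {p v v' d : ℝ} (hp : 1 < p) (hd : 0 < d) (hv : d ≤ v)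
    (hv' : d ≤ v') :
    v' ^ (1 - p) / (p - 1) ≤ v ^ (1 - p) / (p - 1) + d ^ (-p) * |v - v'| := by
  have hv0 : 0 < v := hd.trans_le hv
  have hv0' : 0 < v' := hd.trans_le hv'
  have hp0 : 0 < p := by linarith
  have hp1 : p - 1 ≠ 0 := by linarith
  have h := rpow_div_le_mul_add hp (t := v' ^ (-p)) (by positivity) hv0
  have e : (v' ^ (-p)) ^ (1 - 1/p) = v' ^ (1 - p) := by
    rw [← Real.rpow_mul hv0'.le]; congr 1; field_simp; ring
  have e2 : v' ^ (1 - p) = v' * v' ^ (-p) := by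
    rw [sub_eq_add_neg, Real.rpow_add hv0', Real.rpow_one]
  have e3 : v' ^ (1 - p) / (1 - 1/p) = v' ^ (1 - p) / (p - 1) + v' ^ (1 - p) := by
    have : 1 - 1/p = (p - 1)/p := by field_simp
    rw [this]; field_simp; ring
  rw [e, e3] at h
  have h4 : v' ^ (-p) * (v - v') ≤ d ^ (-p) * |v - v'| :=
    (mul_le_mul_of_nonneg_left (le_abs_self _) (by positivity)).trans
      (mul_le_mul_of_nonneg_right (Real.rpow_le_rpow_of_nonpos hd hv' (by linarith))
        (abs_nonneg _))
  nlinarith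

lemma powEnergy_le_lintegral_add_dualEnergy {n : ℕ} {p : ℝ} (hp : 1 < p) (σ : Measure (En n))
    {v : En n → ℝ} (hv : Measurable v) (hpos : ∀ x, 0 < v x) :
    powEnergy p σ ≤ (∫⁻ x, ENNReal.ofReal (v x) ∂σ) + dualEnergy p v := by
  have h1 : ∫⁻ x, ENNReal.ofReal (v x) * σ.rnDeriv volume x ≤ ∫⁻ x, ENNReal.ofReal (v x) ∂σ := by
    calc _ = ∫⁻ x, ENNReal.ofReal (v x) ∂(volume.withDensity (σ.rnDeriv volume)) := by
          rw [lintegral_withDensity_eq_lintegral_mul _ (Measure.measurable_rnDeriv _ _)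
            hv.ennreal_ofReal]
          simp only [Pi.mul_apply, mul_comm]
      _ ≤ _ := lintegral_mono' (Measure.withDensity_rnDeriv_le _ _) le_rfl
  refine le_trans ?_ (add_le_add_left h1 _)
  rw [dualEnergy, ← lintegral_add_left (by fun_prop), powEnergy]
  refine lintegral_mono fun x => ?_
  refine (ENNReal.ofReal_le_ofReal
    (rpow_div_le_mul_add hp ENNReal.toReal_nonneg (hpos x))).trans ?_
  refine ENNReal.ofReal_add_le.trans ?_
  rw [ENNReal.ofReal_mul (hpos x).le]
  gcongr
  exact ENNReal.ofReal_toReal_le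

lemma limsup_powEnergy_le_of_continuous {n : ℕ} {p : ℝ} (hp : 1 < p)
    {ρseq : ℕ → Measure (En n)} (hprob : ∀ k, IsProbabilityMeasure (ρseq k))
    {ρ : Measure (En n)} [IsProbabilityMeasure ρ]
    (hweak : ∀ g : BoundedContinuousFunction (En n) ℝ,
      Tendsto (fun k => ∫ x, g x ∂(ρseq k)) atTop (𝓝 (∫ x, g x ∂ρ)))
    {C : ℝ≥0∞} (hC : ∀ k, ∫⁻ x, ENNReal.ofReal ‖x‖ ∂(ρseq k) ≤ C)
    {ε : ℝ} (hε : 0 < ε) (w : BoundedContinuousFunction (En n) ℝ) (hw : ∀ x, 0 ≤ w x) :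
    limsup (fun k => powEnergy p (ρseq k)) atTop ≤
      (∫⁻ x, ENNReal.ofReal (w x) ∂ρ) + (ENNReal.ofReal ε * (1 + C)
        + dualEnergy p (fun x => w x + ε * (1 + ‖x‖))) := by
  set K := ENNReal.ofReal ε * (1 + C) + dualEnergy p (fun x => w x + ε * (1 + ‖x‖))
  have e : ∀ (σ : Measure (En n)) [IsProbabilityMeasure σ],
      ∫⁻ x, ENNReal.ofReal (w x) ∂σ = ENNReal.ofReal (∫ x, w x ∂σ) := fun σ _ =>
    (ofReal_integral_eq_lintegral_ofReal (w.integrable σ) (ae_of_all _ hw)).symm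
  have hb : ∀ k, powEnergy p (ρseq k) ≤ (∫⁻ x, ENNReal.ofReal (w x) ∂(ρseq k)) + K := by
    intro k
    have := hprob k
    refine (powEnergy_le_lintegral_add_dualEnergy hp (ρseq k)
      (v := fun x => w x + ε * (1 + ‖x‖)) ?_ ?_).trans ?_
    · have := w.continuous.measurable
      fun_prop
    · intro x
      have := hw x
      positivity
    · rw [← add_assoc]
      gcongr
      calc ∫⁻ x, ENNReal.ofReal (w x + ε * (1 + ‖x‖)) ∂(ρseq k)
          ≤ ∫⁻ x, (ENNReal.ofReal (w x) + ENNReal.ofReal ε * (1 + ENNReal.ofReal ‖x‖))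
              ∂(ρseq k) := by
            refine lintegral_mono fun x => ?_
            rw [ENNReal.ofReal_add (hw x) (by positivity), ENNReal.ofReal_mul hε.le,
              ENNReal.ofReal_add zero_le_one (norm_nonneg _), ENNReal.ofReal_one]
        _ = (∫⁻ x, ENNReal.ofReal (w x) ∂(ρseq k))
            + ENNReal.ofReal ε * (1 + ∫⁻ x, ENNReal.ofReal ‖x‖ ∂(ρseq k)) := by
            rw [lintegral_add_right _ (by fun_prop), lintegral_const_mul _ (by fun_prop),
              lintegral_add_left (by fun_prop)]
            simp
        _ ≤ _ := by gcongr; exact hC k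
  have ht : Tendsto (fun k => (∫⁻ x, ENNReal.ofReal (w x) ∂(ρseq k)) + K) atTop
      (𝓝 ((∫⁻ x, ENNReal.ofReal (w x) ∂ρ) + K)) := by
    refine Tendsto.add_const _ ?_
    rw [e ρ]
    refine (ENNReal.tendsto_ofReal (hweak w)).congr fun k => ?_
    have := hprob k
    exact (e _).symm
  rw [← ht.limsup_eq]
  exact limsup_le_limsup (Eventually.of_forall hb)

lemma exists_boundedContinuous_dual_approx {n : ℕ} {p : ℝ} (hp : (n : ℝ) < p) (hp1 : 1 < p)
    (ρ : Measure (En n)) [IsFiniteMeasure ρ] {ε : ℝ} (hε : 0 < ε)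
    {w : En n → ℝ} (hwm : Measurable w) {N : ℝ} (hw : ∀ x, 0 ≤ w x) (hwN : ∀ x, w x ≤ N)
    {δ : ℝ≥0∞} (hδ : δ ≠ 0) :
    ∃ g : BoundedContinuousFunction (En n) ℝ, (∀ x, 0 ≤ g x) ∧
      (∫⁻ x, ENNReal.ofReal (g x) ∂ρ) + dualEnergy p (fun x => g x + ε * (1 + ‖x‖)) ≤
      (∫⁻ x, ENNReal.ofReal (w x) ∂ρ) + dualEnergy p (fun x => w x + ε * (1 + ‖x‖)) + δ := by
  have hdm : Measurable fun x : En n => ENNReal.ofReal ((ε * (1 + ‖x‖)) ^ (-p)) := by fun_prop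
  set ν : Measure (En n) := volume.withDensity
    fun x => ENNReal.ofReal ((ε * (1 + ‖x‖)) ^ (-p)) with hν
  have hνfin : IsFiniteMeasure ν := by
    refine isFiniteMeasure_withDensity ?_
    have h := finite_integral_one_add_norm (E := En n) (μ := volume) (r := p) (by simpa using hp)
    have : ∀ x : En n, ENNReal.ofReal ((ε * (1 + ‖x‖)) ^ (-p))
        = ENNReal.ofReal (ε ^ (-p)) * ENNReal.ofReal ((1 + ‖x‖) ^ (-p)) := fun x => by
      rw [← ENNReal.ofReal_mul (by positivity), Real.mul_rpow hε.le (by positivity)]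
    simp_rw [this]
    rw [lintegral_const_mul _ (by fun_prop)]
    exact (ENNReal.mul_lt_top ENNReal.ofReal_lt_top h).ne
  have hint : Integrable w (ρ + ν) := Integrable.of_bound hwm.aestronglyMeasurable N
    (ae_of_all _ fun x => by rw [Real.norm_of_nonneg (hw x)]; exact hwN x)
  obtain ⟨g, hg, -⟩ := hint.exists_boundedContinuous_lintegral_sub_le hδ
  refine ⟨g ⊔ 0, fun x => le_max_right _ _, ?_⟩
  have hdist : ∀ x, |w x - (g ⊔ 0) x| ≤ |w x - g x| := fun x => by
    have h := abs_max_sub_max_le_abs (w x) (g x) 0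
    rwa [max_eq_left (hw x)] at h
  have hgm : Measurable g := g.continuous.measurable
  have hgm' : Measurable (g ⊔ 0 : BoundedContinuousFunction (En n) ℝ) :=
    (g ⊔ 0).continuous.measurable
  have hgn : ∀ x, 0 ≤ (g ⊔ 0) x := fun x => le_max_right _ _
  generalize g ⊔ 0 = G at hdist hgm' hgn ⊢
  have h1 : ∫⁻ x, ENNReal.ofReal (G x) ∂ρ ≤
      (∫⁻ x, ENNReal.ofReal (w x) ∂ρ) + ∫⁻ x, ‖w x - g x‖ₑ ∂ρ := by
    rw [← lintegral_add_left (by fun_prop)]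
    refine lintegral_mono fun x => ?_
    rw [Real.enorm_eq_ofReal_abs, ← ENNReal.ofReal_add (hw x) (abs_nonneg _)]
    refine ENNReal.ofReal_le_ofReal ?_
    have := hdist x
    have := neg_abs_le (w x - G x)
    linarith
  have h2 : dualEnergy p (fun x => G x + ε * (1 + ‖x‖)) ≤
      dualEnergy p (fun x => w x + ε * (1 + ‖x‖)) + ∫⁻ x, ‖w x - g x‖ₑ ∂ν := by
    rw [hν, lintegral_withDensity_eq_lintegral_mul _ hdm (by fun_prop), dualEnergy, dualEnergy,
      ← lintegral_add_left (by fun_prop)]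
    refine lintegral_mono fun x => ?_
    have hd : 0 < ε * (1 + ‖x‖) := by positivity
    have hp2 : 0 < p - 1 := by linarith
    have hw0 := hw x
    simp only [Pi.mul_apply]
    rw [Real.enorm_eq_ofReal_abs, ← ENNReal.ofReal_mul (by positivity),
      ← ENNReal.ofReal_add (by positivity) (by positivity)]
    refine ENNReal.ofReal_le_ofReal ?_
    refine (rpow_dual_le_add_abs_sub hp1 hd (v := w x + ε * (1 + ‖x‖)) (by linarith)
      (by linarith [hgn x])).trans ?_
    rw [add_sub_add_right_eq_sub]
    exact add_le_add le_rfl (mul_le_mul_of_nonneg_left (hdist x) (by positivity))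
  rw [lintegral_add_measure] at hg
  calc _ ≤ _ := add_le_add h1 h2
    _ = (∫⁻ x, ENNReal.ofReal (w x) ∂ρ) + dualEnergy p (fun x => w x + ε * (1 + ‖x‖))
      + ((∫⁻ x, ‖w x - g x‖ₑ ∂ρ) + ∫⁻ x, ‖w x - g x‖ₑ ∂ν) := by ring
    _ ≤ _ := by gcongr

lemma rpow_dual_truncated_le {p r d N : ℝ} (hp : 1 < p) (hr : 0 ≤ r) (hd : 0 < d) (hN : 0 < N) :
    (if r ≤ N ^ (-p) then N else r ^ (-(1/p))) * r +
      ((if r ≤ N ^ (-p) then N else r ^ (-(1/p))) + d) ^ (1 - p) / (p - 1) ≤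
    r ^ (1 - 1/p) / (1 - 1/p) + (N + d) ^ (1 - p) / (p - 1) := by
  have hp0 : 0 < p := by linarith
  have hp1 : 0 < p - 1 := by linarith
  have hα : 0 < 1 - 1/p := by rw [sub_pos, div_lt_one hp0]; exact hp
  have hα1 : 1 - 1/p ≤ 1 := by have : 0 < 1/p := by positivity
                               linarith
  split_ifs with h
  · gcongr
    rw [le_div_iff₀ hα]
    rcases hr.eq_or_lt with rfl | hr0
    · simp; positivity
    have h1 : r ^ (1/p) ≤ N⁻¹ := by
      calc r ^ (1/p) ≤ (N ^ (-p)) ^ (1/p) := by gcongr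
        _ = N⁻¹ := by
          rw [← Real.rpow_mul hN.le, ← Real.rpow_neg_one]; congr 1; field_simp
    have h2 : N * r = N * r ^ (1/p) * r ^ (1 - 1/p) := by
      rw [mul_assoc, ← Real.rpow_add hr0]; simp
    have h3 : N * r ^ (1/p) ≤ 1 := by
      calc _ ≤ N * N⁻¹ := by gcongr
        _ = 1 := by field_simp
    have h4 : 0 ≤ r ^ (1 - 1/p) := by positivity
    calc N * r * (1 - 1/p) ≤ N * r * 1 := by gcongr
      _ = N * r ^ (1/p) * r ^ (1 - 1/p) := by rw [mul_one, h2]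
      _ ≤ 1 * r ^ (1 - 1/p) := by gcongr
      _ = _ := one_mul _
  · have hr0 : 0 < r := (Real.rpow_pos_of_pos hN _).trans (not_le.1 h)
    have h1 : r ^ (-(1/p)) * r = r ^ (1 - 1/p) := by
      conv_lhs => rw [← Real.rpow_one r, ← Real.rpow_mul hr, ← Real.rpow_add hr0]
      congr 1; ring
    have h2 : (r ^ (-(1/p)) + d) ^ (1 - p) ≤ r ^ (1 - 1/p) := by
      calc _ ≤ (r ^ (-(1/p))) ^ (1 - p) :=
            Real.rpow_le_rpow_of_nonpos (by positivity) (by linarith) (by linarith)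
        _ = _ := by rw [← Real.rpow_mul hr]; congr 1; field_simp; ring
    have h3 : r ^ (1 - 1/p) / (1 - 1/p) = r ^ (1 - 1/p) + r ^ (1 - 1/p) / (p - 1) := by
      have : 1 - 1/p = (p - 1)/p := by field_simp
      generalize r ^ (1 - 1/p) = y
      rw [this]; field_simp; ring
    have h4 : 0 ≤ (N + d) ^ (1 - p) / (p - 1) := by positivity
    rw [h1, h3]
    have : (r ^ (-(1/p)) + d) ^ (1 - p) / (p - 1) ≤ r ^ (1 - 1/p) / (p - 1) := by gcongr
    linarith

lemma exists_bounded_measurable_dual_le {n : ℕ} {p : ℝ} (hp : 1 < p)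
    (ρ : Measure (En n)) [IsFiniteMeasure ρ] {ε N : ℝ} (hε : 0 < ε) (hN : 0 < N) :
    ∃ w : En n → ℝ, Measurable w ∧ (∀ x, 0 ≤ w x) ∧ (∀ x, w x ≤ N) ∧
      (∫⁻ x, ENNReal.ofReal (w x) ∂ρ) + dualEnergy p (fun x => w x + ε * (1 + ‖x‖)) ≤
      powEnergy p ρ + dualEnergy p (fun x : En n => N + ε * (1 + ‖x‖)) := by
  have hsing := Measure.mutuallySingular_singularPart ρ (volume : Measure (En n))
  set S := hsing.nullSet
  have hS : MeasurableSet S := hsing.measurableSet_nullSet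
  set r : En n → ℝ := fun x => (ρ.rnDeriv volume x).toReal with hr
  have hrm : Measurable r := (Measure.measurable_rnDeriv _ _).ennreal_toReal
  set w₀ : En n → ℝ := fun x => if r x ≤ N ^ (-p) then N else r x ^ (-(1/p)) with hw₀
  have hw₀m : Measurable w₀ :=
    Measurable.ite (measurableSet_le hrm measurable_const) measurable_const (by fun_prop)
  have hp0 : 0 < p := by linarith
  have hrn : ∀ x, 0 ≤ r x := fun x => ENNReal.toReal_nonneg
  have hw₀n : ∀ x, 0 ≤ w₀ x := fun x => by
    have := hrn x
    simp only [hw₀]; split_ifs <;> positivity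
  have hw₀N : ∀ x, w₀ x ≤ N := fun x => by
    simp only [hw₀]
    split_ifs with h
    · exact le_rfl
    · calc r x ^ (-(1/p)) ≤ (N ^ (-p)) ^ (-(1/p)) :=
            Real.rpow_le_rpow_of_nonpos (by positivity) (not_le.1 h).le
              (by have : 0 < 1/p := by positivity
                  linarith)
        _ = N := by
          rw [← Real.rpow_mul hN.le]
          have : -p * -(1/p) = 1 := by field_simp
          rw [this, Real.rpow_one]
  have hwm : Measurable (S.indicator w₀) := hw₀m.indicator hS
  have hae : ∀ᵐ x ∂(volume : Measure (En n)), S.indicator w₀ x = w₀ x := by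
    have : ∀ᵐ x ∂(volume : Measure (En n)), x ∈ S := by
      rw [ae_iff]; exact hsing.measure_compl_nullSet
    filter_upwards [this] with x hx
    simp [hx]
  refine ⟨S.indicator w₀, hwm, fun x => indicator_nonneg (fun x _ => hw₀n x) x,
    fun x => indicator_le' (fun x _ => hw₀N x) (fun _ _ => hN.le) x, ?_⟩
  have h1 : ∫⁻ x, ENNReal.ofReal (S.indicator w₀ x) ∂ρ = ∫⁻ x, ENNReal.ofReal (w₀ x * r x) := by
    conv_lhs => rw [ρ.haveLebesgueDecomposition_add volume]
    rw [lintegral_add_measure, lintegral_withDensity_eq_lintegral_mul _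
      (Measure.measurable_rnDeriv _ _) (by fun_prop)]
    have hz : ∫⁻ x, ENNReal.ofReal (S.indicator w₀ x) ∂(ρ.singularPart volume) = 0 := by
      rw [lintegral_eq_zero_iff (by fun_prop)]
      have : ∀ᵐ x ∂(ρ.singularPart volume), x ∉ S := by
        simpa only [ae_iff, not_not, ofPred_mem_eq] using hsing.measure_nullSet
      filter_upwards [this] with x hx
      simp [hx]
    rw [hz, zero_add]
    refine lintegral_congr_ae ?_
    filter_upwards [hae, ρ.rnDeriv_lt_top volume] with x hx hx'
    rw [Pi.mul_apply, hx, ENNReal.ofReal_mul (hw₀n x), hr, ENNReal.ofReal_toReal hx'.ne, mul_comm]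
  have h2 : dualEnergy p (fun x => S.indicator w₀ x + ε * (1 + ‖x‖))
      = dualEnergy p (fun x => w₀ x + ε * (1 + ‖x‖)) := by
    refine lintegral_congr_ae ?_
    filter_upwards [hae] with x hx
    rw [hx]
  rw [h1, h2, dualEnergy, dualEnergy, powEnergy, ← lintegral_add_left (by fun_prop),
    ← lintegral_add_right _ (by fun_prop)]
  refine lintegral_mono fun x => ?_
  have hp1 : 0 < p - 1 := by linarith
  have hα : 0 < 1 - 1/p := by rw [sub_pos, div_lt_one hp0]; exact hp
  have hx1 := hrn x
  have hx2 := hw₀n x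
  change ENNReal.ofReal _ + ENNReal.ofReal _ ≤
    ENNReal.ofReal (r x ^ (1 - 1/p) / (1 - 1/p)) + ENNReal.ofReal _
  rw [← ENNReal.ofReal_add (by positivity) (by positivity),
    ← ENNReal.ofReal_add (by positivity) (by positivity)]
  exact ENNReal.ofReal_le_ofReal (rpow_dual_truncated_le hp hx1 (by positivity) hN)

lemma tendsto_dualEnergy_const_add {n : ℕ} {p : ℝ} (hp : (n : ℝ) + 1 < p) {ε : ℝ} (hε : 0 < ε) :
    Tendsto (fun N : ℝ => dualEnergy p (fun x : En n => N + ε * (1 + ‖x‖))) atTop (𝓝 0) := by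
  have hp1 : 0 < p - 1 := by have : (0 : ℝ) ≤ n := n.cast_nonneg
                             linarith
  have h := finite_integral_one_add_norm (E := En n) (μ := volume) (r := p - 1)
    (by simp; linarith)
  rw [← lintegral_zero (μ := (volume : Measure (En n)))]
  refine tendsto_lintegral_filter_of_dominated_convergence
    (fun x => ENNReal.ofReal (ε ^ (1 - p) / (p - 1)) * ENNReal.ofReal ((1 + ‖x‖) ^ (-(p - 1))))
    (Eventually.of_forall fun N => by fun_prop) ?_ ?_ ?_
  · filter_upwards [eventually_ge_atTop 0] with N hN
    refine ae_of_all _ fun x => ?_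
    rw [← ENNReal.ofReal_mul (by positivity)]
    refine ENNReal.ofReal_le_ofReal ?_
    rw [div_mul_eq_mul_div, neg_sub, ← Real.mul_rpow hε.le (by positivity)]
    gcongr ?_ / _
    exact Real.rpow_le_rpow_of_nonpos (by positivity) (by linarith) (by linarith)
  · rw [lintegral_const_mul _ (by fun_prop)]
    exact (ENNReal.mul_lt_top ENNReal.ofReal_lt_top h).ne
  · refine ae_of_all _ fun x => ?_
    have h1 : Tendsto (fun N : ℝ => (N + ε * (1 + ‖x‖)) ^ (1 - p) / (p - 1)) atTop (𝓝 0) := by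
      have := ((tendsto_rpow_neg_atTop hp1).comp
        (tendsto_atTop_add_const_right atTop (ε * (1 + ‖x‖)) tendsto_id)).div_const (p - 1)
      simpa [Function.comp_def] using this
    simpa using ENNReal.tendsto_ofReal h1

lemma limsup_powEnergy_le {n : ℕ} {p : ℝ} (hp : (n : ℝ) + 1 < p)
    {ρseq : ℕ → Measure (En n)} (hprob : ∀ k, IsProbabilityMeasure (ρseq k))
    {ρ : Measure (En n)} [IsProbabilityMeasure ρ]
    (hweak : ∀ g : BoundedContinuousFunction (En n) ℝ,
      Tendsto (fun k => ∫ x, g x ∂(ρseq k)) atTop (𝓝 (∫ x, g x ∂ρ)))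
    {C : ℝ≥0∞} (hCtop : C ≠ ⊤) (hC : ∀ k, ∫⁻ x, ENNReal.ofReal ‖x‖ ∂(ρseq k) ≤ C) :
    limsup (fun k => powEnergy p (ρseq k)) atTop ≤ powEnergy p ρ := by
  have hp1 : 1 < p := by have : (0 : ℝ) ≤ n := n.cast_nonneg
                         linarith
  set L := limsup (fun k => powEnergy p (ρseq k)) atTop
  have step : ∀ ε : ℝ, 0 < ε → ∀ N : ℝ, 0 < N → L ≤ ENNReal.ofReal ε * (1 + C) + powEnergy p ρ
      + dualEnergy p (fun x : En n => N + ε * (1 + ‖x‖)) := by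
    intro ε hε N hN
    obtain ⟨w, hwm, hw0, hwN, hw⟩ := exists_bounded_measurable_dual_le hp1 ρ hε hN
    refine ENNReal.le_of_forall_pos_le_add fun δ hδ _ => ?_
    obtain ⟨g, hg0, hg⟩ := exists_boundedContinuous_dual_approx (p := p) (by linarith) hp1 ρ hε
      hwm hw0 hwN (δ := δ) (by exact_mod_cast hδ.ne')
    calc L ≤ _ := limsup_powEnergy_le_of_continuous hp1 hprob hweak hC hε g hg0
      _ = ENNReal.ofReal ε * (1 + C) + ((∫⁻ x, ENNReal.ofReal (g x) ∂ρ)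
          + dualEnergy p (fun x => g x + ε * (1 + ‖x‖))) := by ring
      _ ≤ ENNReal.ofReal ε * (1 + C) + (powEnergy p ρ
          + dualEnergy p (fun x : En n => N + ε * (1 + ‖x‖)) + δ) := by
        exact add_le_add le_rfl (hg.trans (add_le_add hw le_rfl))
      _ = _ := by ring
  have step2 : ∀ ε : ℝ, 0 < ε → L ≤ ENNReal.ofReal ε * (1 + C) + powEnergy p ρ := by
    intro ε hε
    have h := (tendsto_dualEnergy_const_add hp hε).const_add
      (ENNReal.ofReal ε * (1 + C) + powEnergy p ρ)
    rw [add_zero] at h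
    refine ge_of_tendsto h ?_
    filter_upwards [eventually_gt_atTop 0] with N hN using step ε hε N hN
  have h0 : Tendsto (fun ε : ℝ => ENNReal.ofReal ε * (1 + C) + powEnergy p ρ) (𝓝[>] 0)
      (𝓝 (powEnergy p ρ)) := by
    have h1 : Tendsto (fun ε : ℝ => ENNReal.ofReal ε) (𝓝[>] 0) (𝓝 0) := by
      simpa using (ENNReal.tendsto_ofReal (tendsto_id (α := ℝ) (x := 𝓝 0))).mono_left
        nhdsWithin_le_nhds
    have h2 := (ENNReal.Tendsto.mul_const (b := 1 + C) h1
      (Or.inr (by simp [hCtop]))).add_const (powEnergy p ρ)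
    simpa using h2
  refine ge_of_tendsto h0 ?_
  filter_upwards [self_mem_nhdsWithin] with ε hε using step2 ε hε

/-- Lower semicontinuity of `F` along weakly converging sequences
with bounded first moments. -/
theorem qMomentMeasures_F_lsc
    (n : ℕ) (hn : 1 ≤ n) (q : ℝ) (hq : 1 < q)
    (ρseq : ℕ → Measure (En n)) (hprob : ∀ k, IsProbabilityMeasure (ρseq k))
    (ρ : Measure (En n)) [IsProbabilityMeasure ρ]
    (hweak : ∀ g : BoundedContinuousFunction (En n) ℝ,
      Tendsto (fun k => ∫ x, g x ∂(ρseq k)) atTop (𝓝 (∫ x, g x ∂ρ)))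
    (hM : ∃ C : ℝ≥0∞, C ≠ ⊤ ∧ ∀ k, ∫⁻ x, ENNReal.ofReal ‖x‖ ∂(ρseq k) ≤ C) :
    Ffun n q ρ ≤ liminf (fun k => Ffun n q (ρseq k)) atTop := by
  obtain ⟨C, hCtop, hC⟩ := hM
  have h := limsup_powEnergy_le (p := n + q) (by linarith) hprob hweak hCtop hC
  have hanti : Antitone fun y : ℝ≥0∞ => -(y : EReal) := fun a b hab =>
    EReal.neg_le_neg_iff.2 (EReal.coe_ennreal_le_coe_ennreal_iff.2 hab)
  have hcont : Continuous fun y : ℝ≥0∞ => -(y : EReal) :=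
    continuous_neg.comp continuous_coe_ennreal_ereal
  calc Ffun n q ρ ≤ -((limsup (fun k => powEnergy (n + q) (ρseq k)) atTop : ℝ≥0∞) : EReal) :=
        hanti h
    _ = liminf (fun k => Ffun n q (ρseq k)) atTop :=
        hanti.map_limsup_of_continuousAt _ hcont.continuousAt

end
end

section
/- Let α ∈ (0,1) and f(t) := −t^α/α for t ≥ 0, whose derivative is f'(t) = −t^{α−1} for t > 0 (with f'(0) := −∞). Let σ, σ₁: ℝⁿ → [0,+∞) be integrable functions with ∫_{ℝⁿ} f(σ(x)) dx > −∞. Then lim_{ε→0⁺} ∫_{ℝⁿ} (f(σ(x) + ε(σ₁(x) − σ(x))) − f(σ(x)))/ε dx = ∫_{ℝⁿ} f'(σ(x))(σ₁(x) − σ(x)) dx, where the equality holds in [−∞,+∞) (the right-hand side integrand being interpreted as 0 where σ = σ₁ and as −∞ where σ = 0 < σ₁). -/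
open MeasureTheory Topology Filter Set
open scoped ENNReal RealInnerProductSpace

noncomputable section

/-- Difference quotient at `ε` of `t ↦ -t ^ α / α` along the segment from `a` to `b`. -/
def rpowDiffQuot (α a b ε : ℝ) : ℝ :=
  (-((a + ε * (b - a)) ^ α) / α - (-(a ^ α) / α)) / ε

/-- Directional derivative of `t ↦ -t ^ α / α` at `a` towards `b`, equal to `⊥` when
`a = 0 ≠ b`. -/
def rpowDirDeriv (α a b : ℝ) : EReal :=
  if a = b then 0 else if a = 0 then ⊥ else ((-(a ^ (α - 1)) * (b - a) : ℝ) : EReal)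

theorem posPartNN_coe (r : ℝ) : posPartNN (r : EReal) = ENNReal.ofReal r := by
  simp [posPartNN]

theorem posPartNN_neg_coe (r : ℝ) : posPartNN (-(r : EReal)) = ENNReal.ofReal (-r) := by
  rw [← EReal.coe_neg, posPartNN_coe]

theorem rpowDiffQuot_self (α a ε : ℝ) : rpowDiffQuot α a a ε = 0 := by
  simp [rpowDiffQuot]

theorem rpowDiffQuot_le {α a b ε : ℝ} (hα : α ∈ Ioo (0 : ℝ) 1) (ha : 0 ≤ a) (hb : 0 ≤ b)
    (hε : ε ∈ Ioc (0 : ℝ) 1) : rpowDiffQuot α a b ε ≤ a ^ α / α := by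
  have hconc := (Real.concaveOn_rpow hα.1.le hα.2.le).2 (mem_Ici.2 ha) (mem_Ici.2 hb)
    (sub_nonneg.2 hε.2) hε.1.le (by ring)
  simp only [smul_eq_mul] at hconc
  rw [show (1 - ε) * a + ε * b = a + ε * (b - a) by ring] at hconc
  have hbα : 0 ≤ ε * b ^ α := mul_nonneg hε.1.le (Real.rpow_nonneg hb α)
  rw [rpowDiffQuot, div_le_iff₀ hε.1, ← sub_div, div_mul_eq_mul_div]
  gcongr
  · exact hα.1.le
  · linarith

theorem le_rpowDiffQuot {α a b ε : ℝ} (hα : α ∈ Ioo (0 : ℝ) 1) (ha : 0 < a) (hb : 0 ≤ b)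
    (hε : ε ∈ Ioc (0 : ℝ) 1) : -(a ^ (α - 1)) * (b - a) ≤ rpowDiffQuot α a b ε := by
  have hs : -1 ≤ ε * (b - a) / a := by
    rw [le_div_iff₀ ha]
    nlinarith [mul_nonneg hε.1.le hb, mul_nonneg (sub_nonneg.2 hε.2) ha.le]
  have hbern := rpow_one_add_le_one_add_mul_self hs hα.1.le hα.2.le
  have haα : 0 < a ^ α := Real.rpow_pos_of_pos ha α
  have hfac : (a + ε * (b - a)) ^ α = a ^ α * (1 + ε * (b - a) / a) ^ α := by
    rw [← Real.mul_rpow ha.le (by linarith)]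
    congr 1
    field_simp
  have hmul := mul_le_mul_of_nonneg_left hbern haα.le
  rw [← hfac] at hmul
  have hα0 := hα.1
  rw [rpowDiffQuot, le_div_iff₀ hε.1, ← sub_div, le_div_iff₀ hα0, Real.rpow_sub_one ha.ne']
  have heq : a ^ α * (1 + α * (ε * (b - a) / a)) =
      a ^ α + a ^ α / a * (b - a) * ε * α := by
    field_simp
  linarith

theorem tendsto_rpowDiffQuot {α a : ℝ} (b : ℝ) (hα : α ∈ Ioo (0 : ℝ) 1) (ha : 0 < a) :
    Tendsto (rpowDiffQuot α a b) (𝓝[>] 0) (𝓝 (-(a ^ (α - 1)) * (b - a))) := by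
  have hline : HasDerivAt (fun ε : ℝ => a + ε * (b - a)) (b - a) 0 := by
    simpa using ((hasDerivAt_id (0 : ℝ)).mul_const (b - a)).const_add a
  have hpow : HasDerivAt (fun ε : ℝ => -((a + ε * (b - a)) ^ α) / α)
      (-(a ^ (α - 1)) * (b - a)) 0 := by
    have hα0 := hα.1.ne'
    refine (((hline.rpow_const (p := α)
      (Or.inl (by simpa using ha.ne'))).neg).div_const α).congr_deriv ?_
    rw [zero_mul, add_zero]
    field_simp
  refine hpow.tendsto_slope_zero_right.congr fun ε => ?_
  simp only [rpowDiffQuot, zero_add, zero_mul, add_zero, smul_eq_mul]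
  ring

theorem tendsto_rpowDiffQuot_zero {α b : ℝ} (hα : α ∈ Ioo (0 : ℝ) 1) (hb : 0 < b) :
    Tendsto (rpowDiffQuot α 0 b) (𝓝[>] 0) atBot := by
  have hc : 0 < b ^ α / α := div_pos (Real.rpow_pos_of_pos hb α) hα.1
  have hpow := (tendsto_rpow_neg_nhdsGT_zero (y := α - 1) (by linarith [hα.2])).atTop_mul_const hc
  refine (tendsto_neg_atTop_atBot.comp hpow).congr' ?_
  filter_upwards [self_mem_nhdsWithin] with ε hε
  have hε : 0 < ε := hε
  simp only [Function.comp_apply, rpowDiffQuot, Real.zero_rpow hα.1.ne', zero_add, sub_zero,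
    Real.mul_rpow hε.le hb.le, Real.rpow_sub_one hε.ne']
  ring

theorem tendsto_posPartNN_rpowDiffQuot {α a b : ℝ} (hα : α ∈ Ioo (0 : ℝ) 1) (ha : 0 ≤ a)
    (hb : 0 ≤ b) :
    Tendsto (fun ε => ENNReal.ofReal (rpowDiffQuot α a b ε)) (𝓝[>] 0)
      (𝓝 (posPartNN (rpowDirDeriv α a b))) := by
  rcases eq_or_ne a b with rfl | hab
  · simp [rpowDirDeriv, rpowDiffQuot_self, posPartNN]
  rcases ha.eq_or_lt with rfl | ha
  · have hbot := tendsto_rpowDiffQuot_zero hα (hb.lt_of_ne hab)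
    simp only [rpowDirDeriv, if_neg hab, if_true]
    refine tendsto_const_nhds.congr' ?_
    filter_upwards [hbot.eventually (eventually_le_atBot 0)] with ε hε
    simp [posPartNN, ENNReal.ofReal_of_nonpos hε]
  · simp only [rpowDirDeriv, if_neg hab, if_neg ha.ne', posPartNN_coe]
    exact ENNReal.tendsto_ofReal (tendsto_rpowDiffQuot b hα ha)

theorem tendsto_negPart_rpowDiffQuot {α a b : ℝ} (hα : α ∈ Ioo (0 : ℝ) 1) (ha : 0 ≤ a)
    (hb : 0 ≤ b) :
    Tendsto (fun ε => ENNReal.ofReal (-rpowDiffQuot α a b ε)) (𝓝[>] 0)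
      (𝓝 (posPartNN (-rpowDirDeriv α a b))) := by
  rcases eq_or_ne a b with rfl | hab
  · simp [rpowDirDeriv, rpowDiffQuot_self, posPartNN]
  rcases ha.eq_or_lt with rfl | ha
  · simp only [rpowDirDeriv, if_neg hab, if_true, EReal.neg_bot, posPartNN]
    exact ENNReal.tendsto_ofReal_nhds_top.2
      (tendsto_neg_atBot_atTop.comp (tendsto_rpowDiffQuot_zero hα (hb.lt_of_ne hab)))
  · simp only [rpowDirDeriv, if_neg hab, if_neg ha.ne', posPartNN_neg_coe]
    exact ENNReal.tendsto_ofReal (tendsto_rpowDiffQuot b hα ha).neg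

theorem negPart_rpowDiffQuot_le {α a b ε : ℝ} (hα : α ∈ Ioo (0 : ℝ) 1) (ha : 0 ≤ a)
    (hb : 0 ≤ b) (hε : ε ∈ Ioc (0 : ℝ) 1) :
    ENNReal.ofReal (-rpowDiffQuot α a b ε) ≤ posPartNN (-rpowDirDeriv α a b) := by
  rcases eq_or_ne a b with rfl | hab
  · simp [rpowDiffQuot_self]
  rcases ha.eq_or_lt with rfl | ha
  · simp [rpowDirDeriv, hab, posPartNN]
  · simp only [rpowDirDeriv, if_neg hab, if_neg ha.ne', posPartNN_neg_coe]
    exact ENNReal.ofReal_le_ofReal (neg_le_neg (le_rpowDiffQuot hα ha hb hε))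

/-- Convergence of integrals for a family converging to a limit that dominates it, with no
integrability assumption. -/
theorem tendsto_lintegral_of_le_limit {X ι : Type*} [MeasurableSpace X] {ρ : Measure X}
    {l : Filter ι} [l.IsCountablyGenerated] {F : ι → X → ℝ≥0∞} {f : X → ℝ≥0∞}
    (hF : ∀ i, AEMeasurable (F i) ρ) (hle : ∀ᶠ i in l, ∀ x, F i x ≤ f x)
    (hlim : ∀ x, Tendsto (fun i => F i x) l (𝓝 (f x))) :
    Tendsto (fun i => ∫⁻ x, F i x ∂ρ) l (𝓝 (∫⁻ x, f x ∂ρ)) := by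
  rcases l.eq_or_neBot with rfl | _
  · exact tendsto_bot
  refine tendsto_of_le_liminf_of_limsup_le ?_ ?_
  · calc ∫⁻ x, f x ∂ρ = ∫⁻ x, liminf (fun i => F i x) l ∂ρ := by
          simp only [(hlim _).liminf_eq]
      _ ≤ _ := lintegral_liminf_le' hF
  · exact limsup_le_of_le (h := hle.mono fun i hi => lintegral_mono hi)

/-- Differentiation of the local functional along linear
interpolations: the difference quotients of `f(t) = -t^α/α` converge, in the
sense of extended-real-valued integrals, to `∫ f'(σ)(σ₁-σ)`. -/
theorem qMomentMeasures_diff_quotient_limit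
    (n : ℕ) (α : ℝ) (hα : α ∈ Set.Ioo (0 : ℝ) 1)
    (σ σ₁ : En n → ℝ) (hσint : Integrable σ (volume : Measure (En n)))
    (hσ₁int : Integrable σ₁ (volume : Measure (En n)))
    (hσ0 : ∀ x, 0 ≤ σ x) (hσ₁0 : ∀ x, 0 ≤ σ₁ x)
    (hfin : ∫⁻ x, ENNReal.ofReal (σ x ^ α) ∂(volume : Measure (En n)) ≠ ⊤) :
    Tendsto
      (fun ε : ℝ => eInt (volume : Measure (En n)) (fun x =>
        (((-((σ x + ε * (σ₁ x - σ x)) ^ α) / α - (-(σ x ^ α) / α)) / ε : ℝ) : EReal)))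
      (𝓝[>] (0 : ℝ))
      (𝓝 (eInt (volume : Measure (En n)) (fun x =>
        if σ x = σ₁ x then (0 : EReal)
        else if σ x = 0 then (⊥ : EReal)
        else ((-(σ x ^ (α - 1)) * (σ₁ x - σ x) : ℝ) : EReal)))) := by
  change Tendsto (fun ε : ℝ => eInt volume fun x => (rpowDiffQuot α (σ x) (σ₁ x) ε : EReal))
    (𝓝[>] 0) (𝓝 (eInt volume fun x => rpowDirDeriv α (σ x) (σ₁ x)))
  simp only [eInt, posPartNN_coe, posPartNN_neg_coe]
  have hσm := hσint.aemeasurable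
  have hσ₁m := hσ₁int.aemeasurable
  have hmeas (ε : ℝ) : AEMeasurable (fun x => rpowDiffQuot α (σ x) (σ₁ x) ε) := by
    unfold rpowDiffQuot
    fun_prop
  have hIoc : ∀ᶠ ε : ℝ in 𝓝[>] 0, ε ∈ Ioc (0 : ℝ) 1 := Ioc_mem_nhdsGT one_pos
  have hbound : ∫⁻ x, ENNReal.ofReal (σ x ^ α / α) ≠ ⊤ := by
    simp only [div_eq_mul_inv, ENNReal.ofReal_mul (Real.rpow_nonneg (hσ0 _) α)]
    rw [lintegral_mul_const' _ _ ENNReal.ofReal_ne_top]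
    exact ENNReal.mul_ne_top hfin ENNReal.ofReal_ne_top
  have hlim (x : En n) := tendsto_posPartNN_rpowDiffQuot hα (hσ0 x) (hσ₁0 x)
  have hle : ∀ᶠ ε : ℝ in 𝓝[>] 0, ∀ x,
      ENNReal.ofReal (rpowDiffQuot α (σ x) (σ₁ x) ε) ≤ ENNReal.ofReal (σ x ^ α / α) :=
    hIoc.mono fun ε hε x =>
      ENNReal.ofReal_le_ofReal (rpowDiffQuot_le hα (hσ0 x) (hσ₁0 x) hε)
  have hpos := tendsto_lintegral_filter_of_dominated_convergence' (μ := volume) _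
    (Eventually.of_forall fun ε => (hmeas ε).ennreal_ofReal)
    (hle.mono fun _ h => ae_of_all _ h) hbound (ae_of_all _ hlim)
  have hneg := tendsto_lintegral_of_le_limit (ρ := volume)
    (fun ε => (hmeas ε).neg.ennreal_ofReal)
    (hIoc.mono fun ε hε x => negPart_rpowDiffQuot_le hα (hσ0 x) (hσ₁0 x) hε)
    (fun x => tendsto_negPart_rpowDiffQuot hα (hσ0 x) (hσ₁0 x))
  have hpos_fin : ∫⁻ x, posPartNN (rpowDirDeriv α (σ x) (σ₁ x)) ≠ ⊤ :=
    ne_top_of_le_ne_top hbound (lintegral_mono fun x =>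
      le_of_tendsto (hlim x) (hle.mono fun _ h => h x))
  simp only [sub_eq_add_neg]
  refine (EReal.continuousAt_add (Or.inl ?_) (Or.inl ?_)).tendsto.comp
    (((continuous_coe_ennreal_ereal.tendsto _).comp hpos).prodMk_nhds
      (((continuous_neg.comp continuous_coe_ennreal_ereal).tendsto _).comp hneg))
  · simpa using hpos_fin
  · exact EReal.coe_ennreal_ne_bot _


end
end

section
/- Let μ be a probability measure on ℝⁿ with finite first moment and zero barycenter. Then there exists a sequence (μ_k) of compactly supported probability measures on ℝⁿ, each with zero barycenter, converging weakly to μ, such that for every ρ ∈ P_1(ℝⁿ) one has T(ρ,μ_k) → T(ρ,μ) as k → ∞. -/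
open MeasureTheory Topology Filter Set
open scoped ENNReal RealInnerProductSpace

noncomputable section

theorem eInt_coe {X : Type*} [MeasurableSpace X] (ρ : Measure X) (f : X → ℝ) :
    eInt ρ (fun x => (f x : EReal)) =
      ((∫⁻ x, ENNReal.ofReal (f x) ∂ρ : ℝ≥0∞) : EReal)
        - ((∫⁻ x, ENNReal.ofReal (-f x) ∂ρ : ℝ≥0∞) : EReal) := by
  have h : ∀ r : ℝ, posPartNN (r : EReal) = ENNReal.ofReal r := fun r => by simp [posPartNN]
  simp only [eInt, ← EReal.coe_neg, h]

theorem eInt_add_measure_of_integrable {X : Type*} [MeasurableSpace X] (ρ₁ ρ₂ : Measure X)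
    {f : X → ℝ} (hf : Integrable f ρ₂) :
    eInt (ρ₁ + ρ₂) (fun x => (f x : EReal)) =
      eInt ρ₁ (fun x => (f x : EReal)) + ((∫ x, f x ∂ρ₂ : ℝ) : EReal) := by
  have hP : ∫⁻ x, ENNReal.ofReal (f x) ∂ρ₂ ≠ ⊤ := hf.lintegral_lt_top.ne
  have hN : ∫⁻ x, ENNReal.ofReal (-f x) ∂ρ₂ ≠ ⊤ := hf.neg.lintegral_lt_top.ne
  rw [eInt_coe, eInt_coe, lintegral_add_measure, lintegral_add_measure,
    integral_eq_lintegral_pos_part_sub_lintegral_neg_part hf]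
  generalize ∫⁻ x, ENNReal.ofReal (f x) ∂ρ₂ = P at *
  generalize ∫⁻ x, ENNReal.ofReal (-f x) ∂ρ₂ = N at *
  generalize ∫⁻ x, ENNReal.ofReal (f x) ∂ρ₁ = P'
  generalize ∫⁻ x, ENNReal.ofReal (-f x) ∂ρ₁ = N'
  lift P to NNReal using hP
  lift N to NNReal using hN
  induction P' with
  | top =>
    induction N' with
    | top => simp
    | coe N' => simp; norm_cast
  | coe P' =>
    induction N' with
    | top => simp
    | coe N' =>
      have hcoe : ∀ x : NNReal, ((x : ℝ≥0∞) : EReal) = ((x : ℝ) : EReal) := fun _ => rfl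
      simp only [ENNReal.coe_toReal, EReal.coe_ennreal_add, hcoe,
        ← EReal.coe_add, ← EReal.coe_sub, EReal.coe_eq_coe_iff]
      ring

theorem integrable_inner_const {n : ℕ} {ρ : Measure (En n)} [IsFiniteMeasure ρ] (hρ : P1 ρ)
    (γ : Measure (En n × En n)) (hγ : γ.map Prod.fst ≤ ρ) (c : En n) :
    Integrable (fun p : En n × En n => ⟪p.1, c⟫) γ := by
  have h : Integrable (fun x : En n => x) (γ.map Prod.fst) :=
    ((integrable_norm_iff aestronglyMeasurable_id).1 hρ).mono_measure hγ
  exact (h.inner_const c).comp_measurable measurable_fst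

theorem collapse_mem_plans {n : ℕ} {ρ : Measure (En n)} [IsProbabilityMeasure ρ]
    {γ₁ γ₂ : Measure (En n × En n)} {σ τ : Measure (En n)}
    (h : (γ₁ + γ₂).map Prod.fst = ρ) (h₁ : γ₁.map Prod.snd = σ) (h₂ : γ₂ univ = τ univ)
    (c : En n) :
    γ₁ + γ₂.map (fun p => (p.1, c)) ∈ Plans ρ (σ + τ univ • Measure.dirac c) := by
  have hm : Measurable (fun p : En n × En n => (p.1, c)) := by fun_prop
  have hfst : (γ₁ + γ₂.map (fun p => (p.1, c))).map Prod.fst = ρ := by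
    rw [Measure.map_add _ _ measurable_fst, Measure.map_map measurable_fst hm, ← h,
      Measure.map_add _ _ measurable_fst]
    rfl
  refine ⟨?_, hfst, ?_⟩
  · constructor
    rw [← Set.preimage_univ (f := Prod.fst), ← Measure.map_apply measurable_fst .univ, hfst,
      measure_univ]
  · rw [Measure.map_add _ _ measurable_snd, Measure.map_map measurable_snd hm, h₁]
    congr 1
    change γ₂.map (fun _ => c) = _
    rw [Measure.map_const, h₂]

theorem plan_of_collapse {n : ℕ} {ρ σ τ : Measure (En n)} [IsProbabilityMeasure ρ]
    [IsFiniteMeasure σ] [IsFiniteMeasure τ] (hρ : P1 ρ) {c : En n} (hσ : σ {c} = 0)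
    (hτ : Integrable (fun y : En n => y) τ) (hc : ∫ y, y ∂τ = τ.real univ • c)
    {γ : Measure (En n × En n)} (hγ : γ ∈ Plans ρ (σ + τ univ • Measure.dirac c)) :
    ∃ γ' ∈ Plans ρ (σ + τ), eInt γ' (fun p => ((⟪p.1, p.2⟫ : ℝ) : EReal)) =
      eInt γ (fun p => ((⟪p.1, p.2⟫ : ℝ) : EReal)) := by
  obtain ⟨hγp, hfst, hsnd⟩ := hγ
  set S : Set (En n × En n) := Prod.snd ⁻¹' {c} with hS
  have hSm : MeasurableSet S := measurable_snd (measurableSet_singleton c)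
  set α := (γ.restrict S).map Prod.fst with hα
  have hαρ : α ≤ ρ := by
    rw [hα, ← hfst]
    exact Measure.map_mono Measure.restrict_le_self measurable_fst
  have hαuniv : α univ = τ univ := by
    rw [hα, Measure.map_apply measurable_fst .univ, Set.preimage_univ, Measure.restrict_apply_univ,
      hS, ← Measure.map_apply measurable_snd (measurableSet_singleton c), hsnd]
    simp [hσ]
  have hsndc : (γ.restrict Sᶜ).map Prod.snd = σ := by
    rw [hS, ← Set.preimage_compl, ← Measure.restrict_map measurable_snd
      (measurableSet_singleton c).compl, hsnd, Measure.restrict_add, Measure.restrict_smul,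
      restrict_dirac' (measurableSet_singleton c).compl]
    simp only [mem_compl_iff, mem_singleton_iff, not_true_eq_false, if_false, smul_zero, add_zero]
    refine Measure.restrict_eq_self_of_ae_mem ?_
    rw [ae_iff]
    simpa using hσ
  have hfin : IsFiniteMeasure α := by rw [hα]; infer_instance
  have hidα : Integrable (fun x : En n => x) α :=
    ((integrable_norm_iff aestronglyMeasurable_id).1 hρ).mono_measure hαρ
  have hcomp : γ = γ.restrict Sᶜ + γ.restrict S := by
    rw [add_comm, Measure.restrict_add_restrict_compl hSm]
  have hIntS : Integrable (fun p : En n × En n => ⟪p.1, p.2⟫) (γ.restrict S) := by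
    refine (integrable_inner_const hρ (γ.restrict S) hαρ c).congr ?_
    filter_upwards [ae_restrict_mem hSm] with p hp
    rw [show p.2 = c from hp]
  have hintS : ∫ p, ⟪p.1, p.2⟫ ∂(γ.restrict S) = ∫ x, ⟪x, c⟫ ∂α := by
    rw [hα, integral_map measurable_fst.aemeasurable (by fun_prop)]
    refine integral_congr_ae ?_
    filter_upwards [ae_restrict_mem hSm] with p hp
    rw [show p.2 = c from hp]
  have hprod : Integrable (fun p : En n × En n => ⟪p.1, p.2⟫) (α.prod τ) :=
    hidα.op_fst_snd (op := fun x y : En n => (⟪x, y⟫ : ℝ)) (by fun_prop)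
      ⟨1, fun x y => by simpa using norm_inner_le_norm (𝕜 := ℝ) x y⟩ hτ
  have hκ : Integrable (fun p : En n × En n => ⟪p.1, p.2⟫) ((τ univ)⁻¹ • α.prod τ) := by
    by_cases h0 : τ univ = 0
    · have : τ = 0 := Measure.measure_univ_eq_zero.1 h0
      simp [this]
    · exact hprod.smul_measure (by simpa using h0)
  have hκint : ∫ p, ⟪p.1, p.2⟫ ∂((τ univ)⁻¹ • α.prod τ) = ∫ x, ⟪x, c⟫ ∂α := by
    rw [integral_smul_measure, integral_prod _ hprod]
    have h1 : ∀ x : En n, ∫ y, ⟪x, y⟫ ∂τ = τ.real univ * ⟪x, c⟫ := fun x => by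
      rw [integral_inner hτ, hc, inner_smul_right]
    simp only [h1]
    rw [integral_const_mul, ENNReal.toReal_inv, smul_eq_mul, ← mul_assoc]
    by_cases h0 : τ univ = 0
    · have : α = 0 := Measure.measure_univ_eq_zero.1 (hαuniv.trans h0)
      simp [this]
    · rw [Measure.real, inv_mul_cancel₀ (ENNReal.toReal_ne_zero.2 ⟨h0, measure_ne_top _ _⟩),
        one_mul]
  have hκfst : ((τ univ)⁻¹ • α.prod τ).map Prod.fst = α := by
    rw [Measure.map_smul, Measure.map_fst_prod, smul_smul]
    by_cases h0 : τ univ = 0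
    · have : α = 0 := Measure.measure_univ_eq_zero.1 (hαuniv.trans h0)
      simp [this]
    · rw [ENNReal.inv_mul_cancel h0 (measure_ne_top _ _), one_smul]
  have hκsnd : ((τ univ)⁻¹ • α.prod τ).map Prod.snd = τ := by
    rw [Measure.map_smul, Measure.map_snd_prod, smul_smul, hαuniv]
    by_cases h0 : τ univ = 0
    · have : τ = 0 := Measure.measure_univ_eq_zero.1 h0
      simp [this]
    · rw [ENNReal.inv_mul_cancel h0 (measure_ne_top _ _), one_smul]
  have hfst' : (γ.restrict Sᶜ + (τ univ)⁻¹ • α.prod τ).map Prod.fst = ρ := by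
    rw [Measure.map_add _ _ measurable_fst, hκfst, hα, ← Measure.map_add _ _ measurable_fst,
      ← hcomp, hfst]
  refine ⟨γ.restrict Sᶜ + (τ univ)⁻¹ • α.prod τ, ⟨?_, hfst', ?_⟩, ?_⟩
  · constructor
    rw [← Set.preimage_univ (f := Prod.fst), ← Measure.map_apply measurable_fst .univ, hfst',
      measure_univ]
  · rw [Measure.map_add _ _ measurable_snd, hκsnd, hsndc]
  · rw [eInt_add_measure_of_integrable _ _ hκ, hκint, ← hintS,
      ← eInt_add_measure_of_integrable _ _ hIntS, ← hcomp]

/-- Replacing a piece of a measure by a point mass at its barycenter does not increase the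
maximal correlation. -/
theorem Tcorr_collapse_le {n : ℕ} {ρ σ τ : Measure (En n)} [IsProbabilityMeasure ρ]
    [IsFiniteMeasure σ] [IsFiniteMeasure τ] (hρ : P1 ρ) {c : En n}
    (hτ : Integrable (fun y : En n => y) τ) (hc : ∫ y, y ∂τ = τ.real univ • c) :
    Tcorr ρ (σ + τ univ • Measure.dirac c) ≤ Tcorr ρ (σ + τ) := by
  have hσ : σ.restrict {c}ᶜ + σ.restrict {c} = σ := by
    rw [add_comm, Measure.restrict_add_restrict_compl (measurableSet_singleton c)]
  have hI : Integrable (fun y : En n => y) (σ.restrict {c}) := by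
    rw [Measure.restrict_singleton]
    exact (integrable_dirac (by simp)).smul_measure (measure_ne_top _ _)
  have hleft : σ + τ univ • Measure.dirac c =
      σ.restrict {c}ᶜ + (σ.restrict {c} + τ) univ • Measure.dirac c := by
    rw [Measure.add_apply, add_smul, Measure.restrict_apply_univ, ← Measure.restrict_singleton,
      ← add_assoc, hσ]
  have hright : σ + τ = σ.restrict {c}ᶜ + (σ.restrict {c} + τ) := by rw [← add_assoc, hσ]
  rw [hleft, hright]
  refine iSup₂_le fun γ hγ => ?_
  have hbar : ∫ y, y ∂(σ.restrict {c} + τ) = (σ.restrict {c} + τ).real univ • c := by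
    rw [integral_add_measure hI hτ, hc, measureReal_add_apply, add_smul,
      Measure.restrict_singleton, integral_smul_measure, integral_dirac]
    simp [Measure.real]
  obtain ⟨γ', hγ', h⟩ := plan_of_collapse hρ
    (by simp [Measure.restrict_apply (measurableSet_singleton c)]) (hI.add_measure hτ) hbar hγ
  rw [← h]
  exact le_iSup₂ (f := fun γ (_ : γ ∈ Plans ρ _) => eInt γ _) γ' hγ'

theorem tendsto_setLIntegral_of_monotone_of_iUnion_eq_univ {X : Type*} [MeasurableSpace X]
    (γ : Measure X) (f : X → ℝ≥0∞) {S : ℕ → Set X} (hm : ∀ k, MeasurableSet (S k))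
    (hS : Monotone S) (hU : ⋃ k, S k = univ) :
    Tendsto (fun k => ∫⁻ x in S k, f x ∂γ) atTop (𝓝 (∫⁻ x, f x ∂γ)) := by
  have h := tendsto_measure_iUnion_atTop (μ := γ.withDensity f) hS
  rw [hU, withDensity_apply _ .univ, Measure.restrict_univ] at h
  exact h.congr fun k => withDensity_apply _ (hm k)

theorem tendsto_eInt_smul_restrict {X : Type*} [MeasurableSpace X]
    (γ : Measure X) (f : X → ℝ) {S : ℕ → Set X} (hm : ∀ k, MeasurableSet (S k))
    (hS : Monotone S) (hU : ⋃ k, S k = univ) {a : ℕ → ℝ} (ha : Tendsto a atTop (𝓝 1))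
    (hf : ∫⁻ x, ENNReal.ofReal (-f x) ∂γ ≠ ⊤) :
    Tendsto (fun k => eInt (ENNReal.ofReal (a k) • γ.restrict (S k)) (fun x => (f x : EReal)))
      atTop (𝓝 (eInt γ (fun x => (f x : EReal)))) := by
  have ha' : Tendsto (fun k => ENNReal.ofReal (a k)) atTop (𝓝 1) := by
    simpa using ENNReal.tendsto_ofReal ha
  have key : ∀ g : X → ℝ≥0∞, Tendsto (fun k => ∫⁻ x, g x ∂(ENNReal.ofReal (a k) • γ.restrict (S k)))
      atTop (𝓝 (∫⁻ x, g x ∂γ)) := fun g => by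
    have := ENNReal.Tendsto.mul ha' (.inl one_ne_zero)
      (tendsto_setLIntegral_of_monotone_of_iUnion_eq_univ γ g hm hS hU) (.inr ENNReal.one_ne_top)
    simpa [lintegral_smul_measure] using this
  simp only [eInt_coe, sub_eq_add_neg]
  refine (EReal.continuousAt_add (p := (_, _)) (.inr ?_) (.inl ?_)).tendsto.comp
    ((EReal.tendsto_coe_ennreal.2 (key _)).prodMk_nhds
      (EReal.tendsto_coe_ennreal.2 (key _)).neg)
  · simpa using hf
  · simp

/-- The part of `ν` kept by a truncation: the fraction `a` of the restriction of `ν` to `B`. -/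
def kept {X : Type*} [MeasurableSpace X] (a : ℝ) (B : Set X) (ν : Measure X) : Measure X :=
  ENNReal.ofReal a • ν.restrict B

/-- The part of `ν` discarded by a truncation, complementary to `kept a B ν`. -/
def discarded {X : Type*} [MeasurableSpace X] (a : ℝ) (B : Set X) (ν : Measure X) : Measure X :=
  ENNReal.ofReal (1 - a) • ν.restrict B + ν.restrict Bᶜ

section Truncation

variable {X : Type*} [MeasurableSpace X] {a : ℝ} {B : Set X} {ν : Measure X}

instance [IsFiniteMeasure ν] : IsFiniteMeasure (kept a B ν) :=
  Measure.smul_finite _ ENNReal.ofReal_ne_top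

instance [IsFiniteMeasure ν] : IsFiniteMeasure (discarded a B ν) := by
  have : IsFiniteMeasure (ENNReal.ofReal (1 - a) • ν.restrict B) :=
    Measure.smul_finite _ ENNReal.ofReal_ne_top
  unfold discarded
  infer_instance

theorem kept_add_discarded (h0 : 0 ≤ a) (h1 : a ≤ 1) (hB : MeasurableSet B) :
    kept a B ν + discarded a B ν = ν := by
  rw [kept, discarded, ← add_assoc, ← add_smul, ← ENNReal.ofReal_add h0 (by linarith)]
  simp [Measure.restrict_add_restrict_compl hB]

theorem kept_map {Y : Type*} [MeasurableSpace Y] {g : X → Y} (hg : Measurable g) {B : Set Y}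
    (hB : MeasurableSet B) : (kept a (g ⁻¹' B) ν).map g = kept a B (ν.map g) := by
  rw [kept, kept, Measure.map_smul, Measure.restrict_map hg hB]

theorem discarded_preimage_univ {Y : Type*} [MeasurableSpace Y] {g : X → Y} (hg : Measurable g)
    {B : Set Y} (hB : MeasurableSet B) :
    discarded a (g ⁻¹' B) ν univ = discarded a B (ν.map g) univ := by
  simp [discarded, Measure.map_apply hg hB, Measure.map_apply hg hB.compl]

variable {E : Type*} [NormedAddCommGroup E] {f : X → E}

theorem integrable_kept (hf : Integrable f ν) : Integrable f (kept a B ν) :=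
  hf.restrict.smul_measure ENNReal.ofReal_ne_top

theorem integrable_discarded (hf : Integrable f ν) : Integrable f (discarded a B ν) :=
  (hf.restrict.smul_measure ENNReal.ofReal_ne_top).add_measure hf.restrict

variable [NormedSpace ℝ E]

theorem integral_kept (h0 : 0 ≤ a) : ∫ x, f x ∂(kept a B ν) = a • ∫ x in B, f x ∂ν := by
  rw [kept, integral_smul_measure, ENNReal.toReal_ofReal h0]

theorem integral_discarded (h1 : a ≤ 1) (hB : MeasurableSet B) (hf : Integrable f ν) :
    ∫ x, f x ∂(discarded a B ν) = ∫ x, f x ∂ν - a • ∫ x in B, f x ∂ν := by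
  rw [discarded, integral_add_measure (hf.restrict.smul_measure ENNReal.ofReal_ne_top) hf.restrict,
    integral_smul_measure, ENNReal.toReal_ofReal (by linarith), ← integral_add_compl hB hf]
  module

theorem discarded_real_univ [IsProbabilityMeasure ν] (h1 : a ≤ 1) (hB : MeasurableSet B) :
    (discarded a B ν).real univ = 1 - a * ν.real B := by
  have := integral_discarded (f := fun _ => (1 : ℝ)) h1 hB (integrable_const (μ := ν) 1)
  simpa using this

end Truncation

theorem lowerBound_le_Tcorr {n : ℕ} {ρ μ : Measure (En n)} [IsProbabilityMeasure ρ] (hρ : P1 ρ)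
    {a : ℝ} (h0 : 0 ≤ a) (h1 : a ≤ 1) {B : Set (En n)} (hB : MeasurableSet B) (c : En n)
    {γ : Measure (En n × En n)} (hγ : γ ∈ Plans ρ μ) :
    eInt (kept a (Prod.snd ⁻¹' B) γ) (fun p => ((⟪p.1, p.2⟫ : ℝ) : EReal)) +
        ((∫ p, ⟪p.1, c⟫ ∂(discarded a (Prod.snd ⁻¹' B) γ) : ℝ) : EReal) ≤
      Tcorr ρ (kept a B μ + discarded a B μ univ • Measure.dirac c) := by
  obtain ⟨_, hfst, hsnd⟩ := hγ
  have hm : Measurable (fun p : En n × En n => (p.1, c)) := by fun_prop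
  have hplan := collapse_mem_plans (ρ := ρ) (γ₁ := kept a (Prod.snd ⁻¹' B) γ)
    (γ₂ := discarded a (Prod.snd ⁻¹' B) γ) (σ := kept a B μ) (τ := discarded a B μ)
    (by rw [kept_add_discarded h0 h1 (measurable_snd hB), hfst])
    (by rw [kept_map measurable_snd hB, hsnd])
    (by rw [discarded_preimage_univ measurable_snd hB, hsnd]) c
  refine le_trans (le_of_eq ?_) (le_iSup₂ (f := fun γ (_ : γ ∈ Plans ρ _) => eInt γ _) _ hplan)
  have hI := integrable_discarded (a := a) (B := Prod.snd ⁻¹' B)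
    (integrable_inner_const hρ γ hfst.le c)
  have hfun : AEStronglyMeasurable (fun p : En n × En n => ⟪p.1, p.2⟫)
      ((discarded a (Prod.snd ⁻¹' B) γ).map (fun p => (p.1, c))) := by fun_prop
  rw [eInt_add_measure_of_integrable, integral_map hm.aemeasurable hfun]
  exact (integrable_map_measure hfun hm.aemeasurable).2 hI

theorem tendsto_integral_discarded {X E : Type*} [MeasurableSpace X] [NormedAddCommGroup E]
    [NormedSpace ℝ E] {ν : Measure X} {f : X → E} (hf : Integrable f ν)
    {S : ℕ → Set X} (hm : ∀ k, MeasurableSet (S k)) (hS : Monotone S) (hU : ⋃ k, S k = univ)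
    {a : ℕ → ℝ} (h1 : ∀ k, a k ≤ 1) (ha : Tendsto a atTop (𝓝 1)) :
    Tendsto (fun k => ∫ x, f x ∂(discarded (a k) (S k) ν)) atTop (𝓝 0) := by
  have h := tendsto_setIntegral_of_monotone (μ := ν) (f := f) hm hS hf.integrableOn
  rw [hU, Measure.restrict_univ] at h
  have := (ha.smul h).const_sub (∫ x, f x ∂ν)
  simp only [one_smul, sub_self] at this
  exact this.congr fun k => (integral_discarded (h1 k) (hm k) hf).symm

theorem tendsto_Tcorr_collapse {n : ℕ} {ρ μ : Measure (En n)} [IsProbabilityMeasure ρ]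
    [IsProbabilityMeasure μ] (hρ : P1 ρ) (hμ : Integrable (fun y : En n => y) μ)
    {B : ℕ → Set (En n)} (hm : ∀ k, MeasurableSet (B k)) (hB : Monotone B)
    (hU : ⋃ k, B k = univ) {a : ℕ → ℝ} (h0 : ∀ k, 0 ≤ a k) (h1 : ∀ k, a k ≤ 1)
    (ha : Tendsto a atTop (𝓝 1)) {c : ℕ → En n} (hcb : ∀ k, ‖c k‖ ≤ 1)
    (hc : ∀ k, ∫ y, y ∂(discarded (a k) (B k) μ) =
      (discarded (a k) (B k) μ).real univ • c k) :
    Tendsto (fun k => Tcorr ρ (kept (a k) (B k) μ +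
      discarded (a k) (B k) μ univ • Measure.dirac (c k))) atTop (𝓝 (Tcorr ρ μ)) := by
  have hle : ∀ k, Tcorr ρ (kept (a k) (B k) μ +
      discarded (a k) (B k) μ univ • Measure.dirac (c k)) ≤ Tcorr ρ μ := fun k => by
    have := Tcorr_collapse_le (σ := kept (a k) (B k) μ) hρ (integrable_discarded hμ) (hc k)
    rwa [kept_add_discarded (h0 k) (h1 k) (hm k)] at this
  refine tendsto_order.2 ⟨fun b hb => ?_, fun b hb => .of_forall fun k => (hle k).trans_lt hb⟩
  simp only [Tcorr, lt_iSup_iff] at hb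
  obtain ⟨γ, hγ, hbγ⟩ := hb
  have hN : ∫⁻ p, ENNReal.ofReal (-⟪p.1, p.2⟫) ∂γ ≠ ⊤ := fun h => by
    rw [eInt_coe, h] at hbγ
    simp at hbγ
  have hmS : ∀ k, MeasurableSet ((Prod.snd : En n × En n → En n) ⁻¹' B k) :=
    fun k => measurable_snd (hm k)
  have hS : Monotone fun k => (Prod.snd : En n × En n → En n) ⁻¹' B k :=
    fun i j h => Set.preimage_mono (hB h)
  have hSU : ⋃ k, (Prod.snd : En n × En n → En n) ⁻¹' B k = univ := by
    rw [← Set.preimage_iUnion, hU, Set.preimage_univ]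
  have hmain := tendsto_eInt_smul_restrict γ (fun p => ⟪p.1, p.2⟫) hmS hS hSU ha hN
  have hx : Integrable (fun p : En n × En n => ‖p.1‖) γ := by
    have : Integrable (fun x : En n => ‖x‖) (γ.map Prod.fst) := hγ.2.1 ▸ hρ
    exact this.comp_measurable measurable_fst
  have hr : Tendsto (fun k => ∫ p, ⟪p.1, c k⟫ ∂(discarded (a k) (Prod.snd ⁻¹' B k) γ))
      atTop (𝓝 0) := by
    refine squeeze_zero_norm (fun k => ?_) (tendsto_integral_discarded hx hmS hS hSU h1 ha)
    refine norm_integral_le_of_norm_le (integrable_discarded hx) (.of_forall fun p => ?_)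
    exact (norm_inner_le_norm _ _).trans (mul_le_of_le_one_right (norm_nonneg _) (hcb k))
  have hsum := (EReal.continuousAt_add (p := (_, ((0 : ℝ) : EReal))) (.inr (by simp))
    (.inr (by simp))).tendsto.comp (hmain.prodMk_nhds (EReal.tendsto_coe.2 hr))
  simp only [EReal.coe_zero, add_zero] at hsum
  filter_upwards [hsum.eventually (lt_mem_nhds hbγ)] with k hk
  exact hk.trans_le (lowerBound_le_Tcorr hρ (h0 k) (h1 k) (hm k) (c k) hγ)

/-- Approximation of `μ` by compactly supported centered
probability measures, with convergence of the maximal correlation functional. -/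
theorem Tcorr_compact_approximation
    (n : ℕ) (μ : Measure (En n)) [IsProbabilityMeasure μ]
    (hμ1 : P1 μ) (hbar : ∫ y, y ∂μ = (0 : En n)) :
    ∃ μseq : ℕ → Measure (En n),
      (∀ k, IsProbabilityMeasure (μseq k)) ∧
      (∀ k, ∃ K : Set (En n), IsCompact K ∧ μseq k Kᶜ = 0) ∧
      (∀ k, ∫ y, y ∂(μseq k) = (0 : En n)) ∧
      (∀ g : BoundedContinuousFunction (En n) ℝ,
        Tendsto (fun k => ∫ y, g y ∂(μseq k)) atTop (𝓝 (∫ y, g y ∂μ))) ∧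
      (∀ ρ : Measure (En n), IsProbabilityMeasure ρ → P1 ρ →
        Tendsto (fun k => Tcorr ρ (μseq k)) atTop (𝓝 (Tcorr ρ μ))) := by
  have hμ : Integrable (fun y : En n => y) μ :=
    (integrable_norm_iff aestronglyMeasurable_id).1 hμ1
  let B : ℕ → Set (En n) := fun k => Metric.closedBall 0 k
  have hm : ∀ k, MeasurableSet (B k) := fun k => measurableSet_closedBall
  have hB : Monotone B := fun i j h => Metric.closedBall_subset_closedBall (by exact_mod_cast h)
  have hU : ⋃ k, B k = univ := Metric.iUnion_closedBall_nat 0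
  let m : ℕ → En n := fun k => ∫ y in B k, y ∂μ
  have hm0 : Tendsto m atTop (𝓝 0) := by
    have h := tendsto_setIntegral_of_monotone (μ := μ) hm hB hμ.integrableOn
    rwa [hU, Measure.restrict_univ, hbar] at h
  let a : ℕ → ℝ := fun k => 1 - min 1 ‖m k‖
  have h0 : ∀ k, 0 ≤ a k := fun k => sub_nonneg.2 (min_le_left _ _)
  have h1 : ∀ k, a k ≤ 1 := fun k => sub_le_self _ (le_min zero_le_one (norm_nonneg _))
  have ha : Tendsto a atTop (𝓝 1) := by
    have := (tendsto_const_nhds (x := (1 : ℝ))).sub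
      ((tendsto_const_nhds (x := (1 : ℝ))).min hm0.norm)
    simpa using this
  let σ : ℕ → Measure (En n) := fun k => kept (a k) (B k) μ
  let τ : ℕ → Measure (En n) := fun k => discarded (a k) (B k) μ
  let w : ℕ → ℝ := fun k => (τ k).real univ
  have hw : ∀ k, w k = 1 - a k * μ.real (B k) := fun k => discarded_real_univ (h1 k) (hm k)
  have ham : ∀ k, ‖a k • m k‖ ≤ w k := fun k => by
    have hwa : 1 - a k ≤ w k := by
      rw [hw]
      have := mul_le_of_le_one_right (h0 k) (measureReal_le_one (μ := μ) (s := B k))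
      linarith
    refine le_trans ?_ hwa
    rw [norm_smul, Real.norm_of_nonneg (h0 k)]
    rcases le_total 1 ‖m k‖ with h | h
    · simp [a, h]
    · simpa [a, h] using mul_le_of_le_one_left (norm_nonneg (m k)) (h1 k)
  let c : ℕ → En n := fun k => -((w k)⁻¹ • a k • m k)
  have hcb : ∀ k, ‖c k‖ ≤ 1 := fun k => by
    have hw0 : 0 ≤ w k := measureReal_nonneg
    rw [norm_neg, norm_smul, norm_inv, Real.norm_of_nonneg hw0]
    exact inv_mul_le_one_of_le₀ (ham k) hw0
  have hwc : ∀ k, w k • c k = -(a k • m k) := fun k => by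
    by_cases h : w k = 0
    · have := ham k
      rw [h, norm_le_zero_iff] at this
      simp [h, this]
    · rw [smul_neg, smul_inv_smul₀ h]
  have hc : ∀ k, ∫ y, y ∂(τ k) = w k • c k := fun k => by
    rw [hwc, integral_discarded (h1 k) (hm k) hμ, hbar, zero_sub]
  have hintegral : ∀ {F : Type} [NormedAddCommGroup F] [NormedSpace ℝ F] [CompleteSpace F]
      (g : En n → F), Integrable g μ → ∀ k, ∫ y, g y ∂(σ k + τ k univ • Measure.dirac (c k)) =
        a k • ∫ y in B k, g y ∂μ + w k • g (c k) := fun g hg k => by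
    rw [integral_add_measure (integrable_kept hg)
      ((integrable_dirac (by simp)).smul_measure (measure_ne_top _ _)),
      integral_kept (h0 k), integral_smul_measure, integral_dirac]
    rfl
  refine ⟨fun k => σ k + τ k univ • Measure.dirac (c k), fun k => ⟨?_⟩, fun k => ?_, fun k => ?_,
    fun g => ?_, fun ρ _ hρ => tendsto_Tcorr_collapse hρ hμ hm hB hU h0 h1 ha hcb hc⟩
  · have h : (σ k + τ k) univ = 1 := by
      rw [kept_add_discarded (h0 k) (h1 k) (hm k), measure_univ]
    simpa using h
  · refine ⟨B k ∪ {c k}, (isCompact_closedBall _ _).union isCompact_singleton, ?_⟩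
    have hBc : (B k ∪ {c k})ᶜ ⊆ (B k)ᶜ := Set.compl_subset_compl.2 Set.subset_union_left
    have hmeas : MeasurableSet (B k ∪ {c k})ᶜ :=
      ((hm k).union (measurableSet_singleton _)).compl
    have hσ : μ.restrict (B k) (B k ∪ {c k})ᶜ = 0 :=
      measure_mono_null hBc (by simp [Measure.restrict_apply (hm k).compl])
    rw [Measure.add_apply, Measure.smul_apply, Measure.dirac_apply' _ hmeas]
    simp only [σ, kept, Measure.smul_apply, hσ]
    simp
  · rw [hintegral _ hμ, hwc, add_neg_cancel]
  · have hg : Integrable g μ := g.integrable μ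
    have hlim := tendsto_setIntegral_of_monotone (μ := μ) hm hB hg.integrableOn
    rw [hU, Measure.restrict_univ] at hlim
    have hw0 : Tendsto w atTop (𝓝 0) := by
      have := tendsto_integral_discarded (integrable_const (μ := μ) (1 : ℝ)) hm hB hU h1 ha
      simpa [w, τ] using this
    have hrem : Tendsto (fun k => w k • g (c k)) atTop (𝓝 0) :=
      hw0.zero_smul_isBoundedUnder_le
        (isBoundedUnder_of ⟨‖g‖, fun k => g.norm_coe_le_norm (c k)⟩)
    have := (ha.smul hlim).add hrem
    rw [one_smul, add_zero] at this
    exact this.congr fun k => (hintegral g hg k).symm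

end
end

section
/- Let μ be a probability measure on ℝⁿ with finite first moment, zero barycenter, and not supported on any affine hyperplane. Define c(μ) := (1/(2n)) inf{∫_{ℝⁿ} |y·e − ℓ| dμ(y) : e ∈ S^{n−1}, ℓ ∈ ℝ}. Then c(μ) > 0, and for every ρ ∈ P_1(ℝⁿ) with ∫ x dρ(x) = 0 one has T(ρ,μ) ≥ c(μ) ∫_{ℝⁿ} |x| dρ(x). -/
open MeasureTheory Topology Filter Set
open scoped ENNReal RealInnerProductSpace

noncomputable section

/-- A Borel probability measure on the line has a median. -/
theorem exists_median (ν : Measure ℝ) [IsProbabilityMeasure ν] :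
    ∃ ℓ : ℝ, ν.real (Ioi ℓ) ≤ 1 / 2 ∧ ν.real (Iio ℓ) ≤ 1 / 2 := by
  set F := ProbabilityTheory.cdf ν with hF
  set S : Set ℝ := {x | 1 / 2 ≤ F x} with hS
  have hne : S.Nonempty := by
    have h := (ProbabilityTheory.tendsto_cdf_atTop ν).eventually
      (lt_mem_nhds (show (1 / 2 : ℝ) < 1 by norm_num))
    obtain ⟨x, hx⟩ := h.exists
    exact ⟨x, hx.le⟩
  obtain ⟨b, hb⟩ : ∃ b, F b < 1 / 2 :=
    ((ProbabilityTheory.tendsto_cdf_atBot ν).eventually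
      (gt_mem_nhds (show (0 : ℝ) < 1 / 2 by norm_num))).exists
  have hbdd : BddBelow S := by
    refine ⟨b, fun x hx => ?_⟩
    by_contra! hlt
    have := F.mono hlt.le
    have hx' : 1 / 2 ≤ F x := hx
    linarith
  refine ⟨sInf S, ?_, ?_⟩
  · have hge : 1 / 2 ≤ F (sInf S) := by
      have hrc : Tendsto F (𝓝[>] (sInf S)) (𝓝 (F (sInf S))) :=
        (F.right_continuous (sInf S)).mono_left (nhdsWithin_mono _ Ioi_subset_Ici_self)
      refine ge_of_tendsto hrc ?_
      filter_upwards [self_mem_nhdsWithin] with x hx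
      obtain ⟨y, hy, hyx⟩ := exists_lt_of_csInf_lt hne hx
      exact le_trans hy (F.mono hyx.le)
    have h1 : ν.real (Ioi (sInf S)) = 1 - F (sInf S) := by
      rw [← compl_Iic, probReal_compl_eq_one_sub measurableSet_Iic, hF,
        ProbabilityTheory.cdf_eq_real]
    linarith
  · have hlim : Function.leftLim F (sInf S) ≤ 1 / 2 := by
      refine le_of_tendsto (F.mono.tendsto_leftLim (sInf S)) ?_
      filter_upwards [self_mem_nhdsWithin] with x hx
      by_contra! hlt
      exact absurd (csInf_le hbdd (show x ∈ S from hlt.le)) (not_le.2 hx)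
    have h1 : ν (Iio (sInf S)) = ENNReal.ofReal (Function.leftLim F (sInf S) - 0) := by
      conv_lhs => rw [← ProbabilityTheory.measure_cdf ν]
      exact StieltjesFunction.measure_Iio _ (ProbabilityTheory.tendsto_cdf_atBot ν) _
    rw [measureReal_def, h1, sub_zero]
    exact ENNReal.toReal_le_of_le_ofReal (by norm_num) (ENNReal.ofReal_le_ofReal hlim)

/-- A median `ℓ` of `ν` comes with a sign function of `t - ℓ` of zero `ν`-mean. -/
theorem exists_centered_sign (ν : Measure ℝ) [IsProbabilityMeasure ν] :
    ∃ (ℓ : ℝ) (w : ℝ → ℝ), Measurable w ∧ (∀ t, |w t| ≤ 1) ∧ ∫ t, w t ∂ν = 0 ∧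
      ∀ t, (t - ℓ) * w t = |t - ℓ| := by
  obtain ⟨ℓ, hp, hq⟩ := exists_median ν
  set p := ν.real (Ioi ℓ)
  set q := ν.real (Iio ℓ)
  set r := ν.real {ℓ}
  have hsum : q + r + p = 1 := by
    have h1 : ν.real (Iic ℓ) = q + r := by
      rw [← Iio_union_right, measureReal_union (by simp) (measurableSet_singleton ℓ)]
    have h2 := probReal_compl_eq_one_sub (μ := ν) (measurableSet_Iic (a := ℓ))
    rw [compl_Iic, h1] at h2
    change p = _ at h2
    linarith
  have hr0 : 0 ≤ r := measureReal_nonneg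
  obtain ⟨θ, hθ1, hθ⟩ : ∃ θ : ℝ, |θ| ≤ 1 ∧ p - q + θ * r = 0 := by
    rcases hr0.eq_or_lt with h | h
    · exact ⟨0, by simp, by linarith⟩
    · refine ⟨(q - p) / r, ?_, by field_simp; ring⟩
      rw [abs_div, abs_of_pos h, div_le_one h, abs_le]
      constructor <;> linarith
  refine ⟨ℓ, fun t => (Ioi ℓ).indicator (fun _ => 1) t - (Iio ℓ).indicator (fun _ => 1) t
    + ({ℓ} : Set ℝ).indicator (fun _ => θ) t, ?_, ?_, ?_, ?_⟩
  · exact ((measurable_const.indicator measurableSet_Ioi).sub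
      (measurable_const.indicator measurableSet_Iio)).add
      (measurable_const.indicator (measurableSet_singleton ℓ))
  · intro t
    rcases lt_trichotomy t ℓ with h | h | h
    · simp [h, h.ne, h.le]
    · simp [h, hθ1]
    · simp [h, h.ne', h.le]
  · have i1 : Integrable ((Ioi ℓ).indicator (fun _ => (1 : ℝ))) ν :=
      (integrable_const _).indicator measurableSet_Ioi
    have i2 : Integrable ((Iio ℓ).indicator (fun _ => (1 : ℝ))) ν :=
      (integrable_const _).indicator measurableSet_Iio
    have i3 : Integrable (({ℓ} : Set ℝ).indicator (fun _ => θ)) ν :=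
      (integrable_const _).indicator (measurableSet_singleton ℓ)
    rw [integral_add (f := fun t => (Ioi ℓ).indicator (fun _ => (1 : ℝ)) t
      - (Iio ℓ).indicator (fun _ => (1 : ℝ)) t) (i1.sub i2) i3, integral_sub i1 i2,
      integral_indicator_const _ measurableSet_Ioi, integral_indicator_const _ measurableSet_Iio,
      integral_indicator_const _ (measurableSet_singleton ℓ)]
    simp only [smul_eq_mul, mul_one]
    linarith
  · intro t
    rcases lt_trichotomy t ℓ with h | h | h
    · simp [h, h.ne, h.le, abs_of_neg (sub_neg.2 h)]
    · simp [h]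
    · simp [h, h.ne', h.le, abs_of_pos (sub_pos.2 h)]

/-- The `EReal`-valued integral of an integrable real function is its Bochner integral. -/
theorem eInt_coe_of_integrable {X : Type*} [MeasurableSpace X] {γ : Measure X} {g : X → ℝ}
    (hg : Integrable g γ) : eInt γ (fun x => (g x : EReal)) = ((∫ x, g x ∂γ : ℝ) : EReal) := by
  have h1 : ∀ r : ℝ, posPartNN (r : EReal) = ENNReal.ofReal r := fun r => by simp [posPartNN]
  have h2 : ∀ r : ℝ, posPartNN (-(r : EReal)) = ENNReal.ofReal (-r) := fun r => by
    rw [← EReal.coe_neg, h1]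
  have f1 : ∫⁻ x, ENNReal.ofReal (g x) ∂γ ≠ ⊤ := hg.lintegral_lt_top.ne
  have f2 : ∫⁻ x, ENNReal.ofReal (-g x) ∂γ ≠ ⊤ := hg.neg.lintegral_lt_top.ne
  simp only [eInt, h1, h2]
  rw [integral_eq_lintegral_pos_part_sub_lintegral_neg_part hg, EReal.coe_sub,
    EReal.coe_ennreal_toReal f1, EReal.coe_ennreal_toReal f2]

/-- The perturbation `(1 + u ⊗ v) (ρ ⊗ μ)` of the product plan. -/
def tiltedProd {n : ℕ} (ρ μ : Measure (En n)) (u v : En n → ℝ) : Measure (En n × En n) :=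
  (ρ.prod μ).withDensity fun p => ENNReal.ofReal (1 + u p.1 * v p.2)

theorem integrable_of_measurable_of_abs_le_one {Ω : Type*} [MeasurableSpace Ω] {μ : Measure Ω}
    [IsFiniteMeasure μ] {u : Ω → ℝ} (hu : Measurable u) (hu1 : ∀ x, |u x| ≤ 1) :
    Integrable u μ :=
  Integrable.of_bound hu.aestronglyMeasurable 1 (Eventually.of_forall hu1)

theorem one_add_mul_nonneg {a b : ℝ} (ha : |a| ≤ 1) (hb : |b| ≤ 1) : 0 ≤ 1 + a * b := by
  have h : |a * b| ≤ 1 := by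
    rw [abs_mul]
    exact mul_le_one₀ ha (abs_nonneg _) hb
  linarith [(abs_le.1 h).1]

theorem lintegral_one_add_const_mul {n : ℕ} {μ : Measure (En n)} [IsProbabilityMeasure μ]
    {v : En n → ℝ} (hv : Measurable v) (hv1 : ∀ x, |v x| ≤ 1) (hv0 : ∫ x, v x ∂μ = 0)
    {a : ℝ} (ha : |a| ≤ 1) : ∫⁻ y, ENNReal.ofReal (1 + a * v y) ∂μ = 1 := by
  have hvi := integrable_of_measurable_of_abs_le_one (μ := μ) hv hv1
  have hi : Integrable (fun y => 1 + a * v y) μ := (integrable_const _).add (hvi.const_mul a)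
  rw [← ofReal_integral_eq_lintegral_ofReal hi
    (Eventually.of_forall fun y => one_add_mul_nonneg ha (hv1 y)),
    integral_add (integrable_const _) (hvi.const_mul a), integral_const_mul, hv0]
  simp

theorem tiltedProd_mem_plans {n : ℕ} {ρ μ : Measure (En n)} [IsProbabilityMeasure ρ]
    [IsProbabilityMeasure μ] {u v : En n → ℝ}
    (hu : Measurable u) (hu1 : ∀ x, |u x| ≤ 1) (hu0 : ∫ x, u x ∂ρ = 0)
    (hv : Measurable v) (hv1 : ∀ x, |v x| ≤ 1) (hv0 : ∫ x, v x ∂μ = 0) :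
    tiltedProd ρ μ u v ∈ Plans ρ μ := by
  have hm : Measurable fun p : En n × En n => ENNReal.ofReal (1 + u p.1 * v p.2) := by fun_prop
  have hfst : (tiltedProd ρ μ u v).map Prod.fst = ρ := by
    ext A hA
    rw [Measure.map_apply measurable_fst hA, tiltedProd,
      withDensity_apply _ (measurable_fst hA), ← lintegral_indicator (measurable_fst hA),
      lintegral_prod _ (hm.indicator (measurable_fst hA)).aemeasurable]
    have : ∀ x, ∫⁻ y, (Prod.fst ⁻¹' A).indicator
        (fun p : En n × En n => ENNReal.ofReal (1 + u p.1 * v p.2)) (x, y) ∂μ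
        = A.indicator (fun _ => 1) x := by
      intro x
      by_cases hx : x ∈ A
      · simpa [indicator, hx] using lintegral_one_add_const_mul hv hv1 hv0 (hu1 x)
      · simp [indicator, hx]
    simp [this, lintegral_indicator hA]
  have hsnd : (tiltedProd ρ μ u v).map Prod.snd = μ := by
    ext A hA
    rw [Measure.map_apply measurable_snd hA, tiltedProd,
      withDensity_apply _ (measurable_snd hA), ← lintegral_indicator (measurable_snd hA),
      lintegral_prod_symm _ (hm.indicator (measurable_snd hA)).aemeasurable]
    have : ∀ y, ∫⁻ x, (Prod.snd ⁻¹' A).indicator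
        (fun p : En n × En n => ENNReal.ofReal (1 + u p.1 * v p.2)) (x, y) ∂ρ
        = A.indicator (fun _ => 1) y := by
      intro y
      by_cases hy : y ∈ A
      · simpa [indicator, hy, mul_comm] using lintegral_one_add_const_mul hu hu1 hu0 (hv1 y)
      · simp [indicator, hy]
    simp [this, lintegral_indicator hA]
  refine ⟨⟨?_⟩, hfst, hsnd⟩
  rw [← preimage_univ (f := Prod.fst), ← Measure.map_apply measurable_fst MeasurableSet.univ, hfst]
  exact measure_univ

theorem integral_prod_inner {n : ℕ} {ρ μ : Measure (En n)} [IsProbabilityMeasure ρ]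
    [IsProbabilityMeasure μ] {f g : En n → En n} (hf : Integrable f ρ) (hg : Integrable g μ) :
    Integrable (fun p : En n × En n => (⟪f p.1, g p.2⟫ : ℝ)) (ρ.prod μ) ∧
      ∫ p, (⟪f p.1, g p.2⟫ : ℝ) ∂(ρ.prod μ) = ⟪∫ x, f x ∂ρ, ∫ y, g y ∂μ⟫ := by
  have hint : Integrable (fun p : En n × En n => (⟪f p.1, g p.2⟫ : ℝ)) (ρ.prod μ) :=
    Integrable.op_fst_snd (op := fun x y : En n => (⟪x, y⟫ : ℝ)) (by fun_prop)
      ⟨1, fun x y => by simpa using norm_inner_le_norm (𝕜 := ℝ) x y⟩ hf hg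
  refine ⟨hint, ?_⟩
  rw [integral_prod _ hint]
  simp only [integral_inner hg]
  simp only [real_inner_comm (∫ y, g y ∂μ)]
  rw [← integral_inner hf]

/-- Bounded centered weights on the two marginals give a lower bound for the maximal
correlation. -/
theorem le_Tcorr_of_centered {n : ℕ} {ρ μ : Measure (En n)} [IsProbabilityMeasure ρ]
    [IsProbabilityMeasure μ] (hρ : Integrable (fun x => x) ρ) (hμ : Integrable (fun x => x) μ)
    (hbar : ∫ y, y ∂μ = 0) {u v : En n → ℝ}
    (hu : Measurable u) (hu1 : ∀ x, |u x| ≤ 1) (hu0 : ∫ x, u x ∂ρ = 0)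
    (hv : Measurable v) (hv1 : ∀ x, |v x| ≤ 1) (hv0 : ∫ x, v x ∂μ = 0) :
    ((⟪∫ x, u x • x ∂ρ, ∫ y, v y • y ∂μ⟫ : ℝ) : EReal) ≤ Tcorr ρ μ := by
  have hm : Measurable fun p : En n × En n => ENNReal.ofReal (1 + u p.1 * v p.2) := by fun_prop
  have hlt : ∀ᵐ p ∂(ρ.prod μ), ENNReal.ofReal (1 + u p.1 * v p.2) < ⊤ :=
    Eventually.of_forall fun _ => ENNReal.ofReal_lt_top
  have hux : Integrable (fun x => u x • x) ρ :=
    hρ.bdd_smul 1 hu.aestronglyMeasurable (Eventually.of_forall hu1)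
  have hvy : Integrable (fun y => v y • y) μ :=
    hμ.bdd_smul 1 hv.aestronglyMeasurable (Eventually.of_forall hv1)
  obtain ⟨i1, e1⟩ := integral_prod_inner hρ hμ
  obtain ⟨i2, e2⟩ := integral_prod_inner hux hvy
  have heq : (fun p : En n × En n =>
      (ENNReal.ofReal (1 + u p.1 * v p.2)).toReal • (⟪p.1, p.2⟫ : ℝ))
      = fun p => (⟪p.1, p.2⟫ : ℝ) + ⟪u p.1 • p.1, v p.2 • p.2⟫ := by
    funext p
    rw [ENNReal.toReal_ofReal (one_add_mul_nonneg (hu1 _) (hv1 _)), real_inner_smul_left,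
      real_inner_smul_right, smul_eq_mul]
    ring
  have hint : Integrable (fun p : En n × En n => (⟪p.1, p.2⟫ : ℝ)) (tiltedProd ρ μ u v) := by
    rw [tiltedProd, integrable_withDensity_iff_integrable_smul' hm hlt, heq]
    exact i1.add i2
  have hval : ∫ p, (⟪p.1, p.2⟫ : ℝ) ∂(tiltedProd ρ μ u v)
      = ⟪∫ x, u x • x ∂ρ, ∫ y, v y • y ∂μ⟫ := by
    rw [tiltedProd, integral_withDensity_eq_integral_toReal_smul hm hlt, heq,
      integral_add i1 i2, e1, e2, hbar, inner_zero_right, zero_add]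
  rw [← hval, ← eInt_coe_of_integrable hint]
  exact le_iSup₂_of_le _ (tiltedProd_mem_plans hu hu1 hu0 hv hv1 hv0) le_rfl

/-- The mean absolute deviation of `⟪y, e⟫` from a median is realised by a centered weight. -/
theorem exists_weight_inner_eq {n : ℕ} {μ : Measure (En n)} [IsProbabilityMeasure μ]
    (hμ : Integrable (fun x => x) μ) (e : En n) :
    ∃ (ℓ : ℝ) (v : En n → ℝ), Measurable v ∧ (∀ y, |v y| ≤ 1) ∧ ∫ y, v y ∂μ = 0 ∧
      (⟪e, ∫ y, v y • y ∂μ⟫ : ℝ) = ∫ y, |⟪y, e⟫ - ℓ| ∂μ := by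
  have hY : Measurable fun y : En n => (⟪y, e⟫ : ℝ) := by fun_prop
  have := Measure.isProbabilityMeasure_map (μ := μ) hY.aemeasurable
  obtain ⟨ℓ, w, hw, hw1, hw0, hwℓ⟩ := exists_centered_sign (μ.map fun y => (⟪y, e⟫ : ℝ))
  have hv : Measurable fun y : En n => w ⟪y, e⟫ := hw.comp hY
  have hv0 : ∫ y, w ⟪y, e⟫ ∂μ = 0 := by
    rw [← hw0, integral_map hY.aemeasurable hw.aestronglyMeasurable]
  have hvi := integrable_of_measurable_of_abs_le_one (μ := μ) hv fun y => hw1 _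
  have hvy : Integrable (fun y : En n => w ⟪y, e⟫ • y) μ :=
    hμ.bdd_smul 1 hv.aestronglyMeasurable (Eventually.of_forall fun y => hw1 _)
  refine ⟨ℓ, fun y => w ⟪y, e⟫, hv, fun y => hw1 _, hv0, ?_⟩
  have hpt : ∀ y : En n, |(⟪y, e⟫ : ℝ) - ℓ| = ⟪e, w ⟪y, e⟫ • y⟫ - ℓ * w ⟪y, e⟫ := by
    intro y
    rw [← hwℓ, real_inner_smul_right, real_inner_comm]
    ring
  simp only [hpt]
  rw [integral_sub (hvy.const_inner e) (hvi.const_mul ℓ), integral_const_mul, hv0,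
    integral_inner hvy]
  simp

/-- Half of the mean of `|⟪x, e⟫|` is realised by a centered weight, if the barycenter is zero. -/
theorem exists_weight_inner_eq_half {n : ℕ} {ρ : Measure (En n)} [IsProbabilityMeasure ρ]
    (hρ : Integrable (fun x => x) ρ) (hbar : ∫ x, x ∂ρ = 0) (e : En n) :
    ∃ u : En n → ℝ, Measurable u ∧ (∀ x, |u x| ≤ 1) ∧ ∫ x, u x ∂ρ = 0 ∧
      (⟪e, ∫ x, u x • x ∂ρ⟫ : ℝ) = (∫ x, |(⟪e, x⟫ : ℝ)| ∂ρ) / 2 := by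
  obtain ⟨s, hs, hs1, hse⟩ : ∃ s : En n → ℝ, Measurable s ∧ (∀ x, |s x| ≤ 1) ∧
      ∀ x, s x * ⟪e, x⟫ = |(⟪e, x⟫ : ℝ)| := by
    have hA : MeasurableSet {x : En n | (0 : ℝ) ≤ ⟪e, x⟫} :=
      measurableSet_le measurable_const (by fun_prop)
    classical
    refine ⟨fun x => if (0 : ℝ) ≤ ⟪e, x⟫ then 1 else -1,
      Measurable.ite hA measurable_const measurable_const, fun x => ?_, fun x => ?_⟩
    · dsimp only
      split_ifs <;> simp
    · dsimp only
      split_ifs with h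
      · rw [one_mul, abs_of_nonneg h]
      · rw [neg_one_mul, abs_of_neg (not_le.1 h)]
  have hsi := integrable_of_measurable_of_abs_le_one (μ := ρ) hs hs1
  have hsx : Integrable (fun x => s x • x) ρ :=
    hρ.bdd_smul 1 hs.aestronglyMeasurable (Eventually.of_forall hs1)
  set m := ∫ x, s x ∂ρ with hm
  have hm1 : |m| ≤ 1 := by
    have := norm_integral_le_of_norm_le_const (μ := ρ) (f := s) (C := 1)
      (Eventually.of_forall hs1)
    simpa using this
  refine ⟨fun x => (s x - m) / 2, by fun_prop, fun x => ?_, ?_, ?_⟩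
  · have h1 := abs_le.1 (hs1 x)
    have h2 := abs_le.1 hm1
    rw [abs_le]
    constructor <;> linarith
  · rw [integral_div, integral_sub hsi (integrable_const _)]
    simp [← hm]
  · have hpt : ∀ x : En n, ((s x - m) / 2) • x = (1 / 2 : ℝ) • (s x • x - m • x) := by
      intro x
      rw [← sub_smul, smul_smul]
      congr 1
      ring
    have hmx : Integrable (fun x => m • x) ρ := hρ.smul m
    simp only [hpt]
    rw [integral_smul, integral_sub hsx hmx, integral_smul, hbar, smul_zero, sub_zero,
      real_inner_smul_right, ← integral_inner hsx]
    simp only [real_inner_smul_right, hse]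
    ring

/-- Some coordinate carries at least the fraction `1 / n` of the first moment. -/
theorem exists_coord_integral_norm_le {n : ℕ} (hn : 1 ≤ n) {ρ : Measure (En n)}
    (hρ : Integrable (fun x => x) ρ) :
    ∃ e : En n, ‖e‖ = 1 ∧ (∫ x, ‖x‖ ∂ρ) / n ≤ ∫ x, |(⟪e, x⟫ : ℝ)| ∂ρ := by
  set b := EuclideanSpace.basisFun (Fin n) ℝ
  have hi : ∀ i, Integrable (fun x => |(⟪b i, x⟫ : ℝ)|) ρ := fun i => (hρ.const_inner (b i)).abs
  have hpt : ∀ x : En n, ‖x‖ ≤ ∑ i, |(⟪b i, x⟫ : ℝ)| := by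
    intro x
    calc ‖x‖ = ‖∑ i, (⟪b i, x⟫ : ℝ) • b i‖ := by rw [b.sum_repr' x]
      _ ≤ ∑ i, ‖(⟪b i, x⟫ : ℝ) • b i‖ := norm_sum_le _ _
      _ = ∑ i, |(⟪b i, x⟫ : ℝ)| := by simp [norm_smul]
  have hsum : ∫ x, ‖x‖ ∂ρ ≤ ∑ i, ∫ x, |(⟪b i, x⟫ : ℝ)| ∂ρ := by
    rw [← integral_finsetSum _ fun i _ => hi i]
    exact integral_mono hρ.norm (integrable_finsetSum _ fun i _ => hi i) hpt
  have hn0 : (0 : ℝ) < n := by exact_mod_cast hn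
  have : Nonempty (Fin n) := ⟨⟨0, hn⟩⟩
  obtain ⟨i, -, h⟩ := Finset.exists_le_of_sum_le (s := Finset.univ)
    (f := fun _ : Fin n => (∫ x, ‖x‖ ∂ρ) / n) (g := fun i => ∫ x, |(⟪b i, x⟫ : ℝ)| ∂ρ)
    Finset.univ_nonempty (by
      simp only [Finset.sum_const, Finset.card_univ, Fintype.card_fin, nsmul_eq_mul]
      rw [mul_div_cancel₀ _ hn0.ne']
      exact hsum)
  exact ⟨b i, b.norm_eq_one i, h⟩

/-- A centered measure not carried by a hyperplane has mean absolute deviations bounded below,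
uniformly in the direction and in the reference level. -/
theorem exists_pos_le_integral_abs_inner_sub {n : ℕ} (hn : 1 ≤ n) {μ : Measure (En n)}
    [IsProbabilityMeasure μ] (hμ : Integrable (fun x => x) μ) (hbar : ∫ y, y ∂μ = 0)
    (hplane : NotHyperplane μ) :
    ∃ δ : ℝ, 0 < δ ∧ ∀ e : En n, ‖e‖ = 1 → ∀ ℓ : ℝ, δ ≤ ∫ y, |(⟪y, e⟫ : ℝ) - ℓ| ∂μ := by
  set g : En n → ℝ := fun e => ∫ y, |(⟪y, e⟫ : ℝ)| ∂μ with hg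
  have hi : ∀ e : En n, Integrable (fun y => (⟪y, e⟫ : ℝ)) μ := fun e => hμ.inner_const e
  have hcont : Continuous g := by
    refine continuous_iff_continuousAt.2 fun e₀ => ?_
    refine continuousAt_of_dominated (bound := fun y => ‖y‖ * (‖e₀‖ + 1)) ?_ ?_ ?_ ?_
    · exact Eventually.of_forall fun e => (hi e).abs.aestronglyMeasurable
    · filter_upwards [Metric.ball_mem_nhds e₀ one_pos] with e he
      refine Eventually.of_forall fun y => ?_
      have h1 : ‖e‖ ≤ ‖e₀‖ + 1 := by
        have := norm_le_norm_add_norm_sub' e e₀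
        have h2 : ‖e - e₀‖ < 1 := by simpa [dist_eq_norm] using he
        linarith
      simp only [Real.norm_eq_abs, abs_abs]
      exact (abs_real_inner_le_norm y e).trans (by gcongr)
    · exact hμ.norm.mul_const _
    · exact Eventually.of_forall fun y => by fun_prop
  have hpos : ∀ e : En n, ‖e‖ = 1 → 0 < g e := by
    intro e he
    have h0 : 0 ≤ g e := integral_nonneg fun y => abs_nonneg _
    refine lt_of_le_of_ne h0 fun h => ?_
    have hae := (integral_eq_zero_iff_of_nonneg (fun y => abs_nonneg _) (hi e).abs).1 h.symm
    refine hplane e 0 (by rintro rfl; simp at he) ?_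
    rw [← measure_univ (μ := μ)]
    refine measure_congr ?_
    filter_upwards [hae] with y hy
    have : (⟪y, e⟫ : ℝ) = 0 := by simpa using hy
    exact eq_iff_iff.2 ⟨fun _ => trivial, fun _ => this⟩
  have : Nonempty (Fin n) := ⟨⟨0, hn⟩⟩
  obtain ⟨e₀, he₀, hmin⟩ := (isCompact_sphere (0 : En n) 1).exists_isMinOn
    (NormedSpace.sphere_nonempty.2 zero_le_one) hcont.continuousOn
  refine ⟨g e₀ / 2, half_pos (hpos e₀ (by simpa using he₀)), fun e he ℓ => ?_⟩
  have hge : g e₀ ≤ g e := hmin (by simpa using he)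
  have hsub : Integrable (fun y => (⟪y, e⟫ : ℝ) - ℓ) μ := (hi e).sub (integrable_const _)
  have h1 : |ℓ| ≤ ∫ y, |(⟪y, e⟫ : ℝ) - ℓ| ∂μ := by
    have hmean : ∫ y, ((⟪y, e⟫ : ℝ) - ℓ) ∂μ = -ℓ := by
      rw [integral_sub (hi e) (integrable_const _)]
      simp only [fun y => real_inner_comm e y]
      rw [integral_inner hμ, hbar]
      simp
    have := abs_integral_le_integral_abs (μ := μ) (f := fun y => (⟪y, e⟫ : ℝ) - ℓ)
    rwa [hmean, abs_neg] at this
  have h2 : g e ≤ (∫ y, |(⟪y, e⟫ : ℝ) - ℓ| ∂μ) + |ℓ| := by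
    have hm : g e ≤ ∫ y, (|(⟪y, e⟫ : ℝ) - ℓ| + |ℓ|) ∂μ :=
      integral_mono (hi e).abs (hsub.abs.add (integrable_const _)) fun y => by
        simpa using abs_add_le ((⟪y, e⟫ : ℝ) - ℓ) ℓ
    rw [integral_add hsub.abs (integrable_const _)] at hm
    simpa using hm
  linarith

/-- Lower bound on the maximal correlation functional:
`T(ρ,μ) ≥ c(μ) ∫|x|dρ` for centered `ρ`, with `c(μ) > 0` when `μ` is not
supported on a hyperplane. -/
theorem Tcorr_lower_bound
    (n : ℕ) (hn : 1 ≤ n) (μ : Measure (En n)) [IsProbabilityMeasure μ]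
    (hμ1 : P1 μ) (hbar : ∫ y, y ∂μ = (0 : En n)) (hplane : NotHyperplane μ)
    (cμ : ℝ)
    (hcμ : cμ = (1 / (2 * (n : ℝ))) *
      sInf {r : ℝ | ∃ e : En n, ‖e‖ = 1 ∧ ∃ ℓ : ℝ, r = ∫ y, |⟪y, e⟫ - ℓ| ∂μ}) :
    0 < cμ ∧
      ∀ ρ : Measure (En n), IsProbabilityMeasure ρ → P1 ρ → (∫ x, x ∂ρ = (0 : En n)) →
        ((cμ * ∫ x, ‖x‖ ∂ρ : ℝ) : EReal) ≤ Tcorr ρ μ := by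
  have hn0 : (0 : ℝ) < n := by exact_mod_cast hn
  have hμ : Integrable (fun x : En n => x) μ :=
    (integrable_norm_iff measurable_id.aestronglyMeasurable).1 hμ1
  set S : Set ℝ := {r : ℝ | ∃ e : En n, ‖e‖ = 1 ∧ ∃ ℓ : ℝ, r = ∫ y, |⟪y, e⟫ - ℓ| ∂μ} with hS
  obtain ⟨δ, hδ, hle⟩ := exists_pos_le_integral_abs_inner_sub hn hμ hbar hplane
  have hSδ : ∀ r ∈ S, δ ≤ r := by
    rintro r ⟨e, he, ℓ, rfl⟩
    exact hle e he ℓ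
  have hbdd : BddBelow S := ⟨δ, hSδ⟩
  obtain ⟨e₁, he₁, -⟩ := exists_coord_integral_norm_le hn hμ
  have hIδ : δ ≤ sInf S := le_csInf ⟨_, e₁, he₁, 0, rfl⟩ hSδ
  have hc : 0 < cμ := by
    rw [hcμ]
    have : 0 < sInf S := hδ.trans_le hIδ
    positivity
  refine ⟨hc, fun ρ hρprob hρ1 hρbar => ?_⟩
  have hρ : Integrable (fun x : En n => x) ρ :=
    (integrable_norm_iff measurable_id.aestronglyMeasurable).1 hρ1
  obtain ⟨e, he, hcoord⟩ := exists_coord_integral_norm_le hn hρ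
  obtain ⟨u, hu, hu1, hu0, hue⟩ := exists_weight_inner_eq_half hρ hρbar e
  set a := ∫ x, u x • x ∂ρ with ha
  have hanorm : (∫ x, ‖x‖ ∂ρ) / n / 2 ≤ ‖a‖ := by
    have h := real_inner_le_norm e a
    rw [he, one_mul, hue] at h
    linarith
  have hca : cμ * ∫ x, ‖x‖ ∂ρ ≤ ‖a‖ * sInf S := by
    calc cμ * ∫ x, ‖x‖ ∂ρ = (∫ x, ‖x‖ ∂ρ) / n / 2 * sInf S := by
          rw [hcμ]
          field_simp
      _ ≤ ‖a‖ * sInf S := mul_le_mul_of_nonneg_right hanorm (hδ.le.trans hIδ)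
  obtain ⟨v, hv, hv1, hv0, hva⟩ : ∃ v : En n → ℝ, Measurable v ∧ (∀ y, |v y| ≤ 1) ∧
      ∫ y, v y ∂μ = 0 ∧ ‖a‖ * sInf S ≤ ⟪a, ∫ y, v y • y ∂μ⟫ := by
    by_cases ha0 : a = 0
    · exact ⟨fun _ => 0, measurable_const, by simp, by simp, by simp [ha0]⟩
    · have hapos : 0 < ‖a‖ := norm_pos_iff.2 ha0
      obtain ⟨ℓ, v, hv, hv1, hv0, hve⟩ := exists_weight_inner_eq hμ (‖a‖⁻¹ • a)
      refine ⟨v, hv, hv1, hv0, ?_⟩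
      have hmem : (∫ y, |(⟪y, ‖a‖⁻¹ • a⟫ : ℝ) - ℓ| ∂μ) ∈ S :=
        ⟨_, norm_smul_inv_norm (𝕜 := ℝ) ha0, ℓ, rfl⟩
      have h := csInf_le hbdd hmem
      rw [← hve, real_inner_smul_left, inv_mul_eq_div, le_div_iff₀ hapos] at h
      linarith
  exact (EReal.coe_le_coe_iff.2 (hca.trans hva)).trans
    (le_Tcorr_of_centered hρ hμ hbar hu hu1 hu0 hv hv1 hv0)

end
end

section
/- Let n ≥ 1 and q > 0, and let φ: ℝⁿ → [0,+∞] be a convex lower semicontinuous function such that ∫_{ℝⁿ} φ(x)^{−(n+q)} dx = 1 (with the conventions (+∞)^{−(n+q)} = 0 and 0^{−(n+q)} = +∞). Then inf_{x ∈ ℝⁿ} φ(x) > 0; in particular φ(x) > 0 for every x ∈ ℝⁿ and the probability density φ^{−(n+q)} is bounded. -/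
open MeasureTheory Topology Filter Set
open scoped ENNReal RealInnerProductSpace

noncomputable section

/-- A convex, lower semicontinuous function with values in `ℝ ∪ {+∞}`,
convexity being expressed through the epigraph. -/
def ConvexLSC {n : ℕ} (u : En n → EReal) : Prop :=
  LowerSemicontinuous u ∧ Convex ℝ {p : En n × ℝ | u p.1 ≤ (p.2 : EReal)}

theorem posPartNN_le_ofReal {x : EReal} {c : ℝ} (h0 : 0 ≤ x) (h : x ≤ (c : EReal)) :
    posPartNN x ≤ ENNReal.ofReal c := by
  have hx : x ≠ ⊤ := (h.trans_lt (EReal.coe_lt_top c)).ne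
  rw [posPartNN, if_neg hx]
  refine ENNReal.ofReal_le_ofReal ?_
  have hb : x ≠ ⊥ := (EReal.bot_lt_zero.trans_le h0).ne'
  rw [← EReal.coe_le_coe_iff, EReal.coe_toReal hx hb]
  exact h

theorem ofReal_le_posPartNN {x : EReal} {c : ℝ} (h : (c : EReal) ≤ x) :
    ENNReal.ofReal c ≤ posPartNN x := by
  unfold posPartNN
  split_ifs with hx
  · exact le_top
  · refine ENNReal.ofReal_le_ofReal ?_
    have hb : x ≠ ⊥ := ((EReal.bot_lt_coe c).trans_le h).ne'
    rw [← EReal.coe_le_coe_iff, EReal.coe_toReal hx hb]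
    exact h

/-- If a negative power of `φ` has nonzero integral, some sublevel set of `φ` is not null. -/
theorem exists_volume_sublevel_ne_zero {n : ℕ} {p : ℝ} (hp : 0 < p) {φ : En n → EReal}
    (h : ∫⁻ x, posPartNN (φ x) ^ (-p) ≠ 0) :
    ∃ C : ℝ, 0 < C ∧ volume {x | φ x ≤ (C : EReal)} ≠ 0 := by
  by_contra! hC
  refine h ?_
  have hae : ∀ᵐ x, ∀ k : ℕ, ¬ φ x ≤ (((k : ℝ) + 1 : ℝ) : EReal) := by
    rw [ae_all_iff]
    intro k
    rw [ae_iff]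
    simpa only [not_not] using hC ((k : ℝ) + 1) (by positivity)
  rw [← lintegral_zero (μ := (volume : Measure (En n)))]
  refine lintegral_congr_ae ?_
  filter_upwards [hae] with x hx
  have htop : φ x = ⊤ := by
    rw [EReal.eq_top_iff_forall_lt]
    intro y
    obtain ⟨k, hk⟩ := exists_nat_ge y
    refine lt_of_le_of_lt ?_ (not_le.mp (hx k))
    exact EReal.coe_le_coe_iff.mpr (by linarith)
  simp [htop, posPartNN, ENNReal.top_rpow_of_neg (neg_lt_zero.mpr hp)]

/-- If `φ x ≤ t * C`, the homothety of centre `x` and ratio `t` maps the sublevel set at height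
`C` into the one at height `2 * t * C`. -/
theorem homothety_image_sublevel_subset {n : ℕ} {φ : En n → EReal} (hφ : ConvexLSC φ)
    {C t : ℝ} (hC : 0 ≤ C) (ht0 : 0 ≤ t) (ht1 : t ≤ 1) {x : En n}
    (hx : φ x ≤ ((t * C : ℝ) : EReal)) :
    AffineMap.homothety x t '' {y | φ y ≤ (C : EReal)} ⊆
      {y | φ y ≤ ((2 * t * C : ℝ) : EReal)} := by
  rintro _ ⟨y, hy, rfl⟩
  have h := hφ.2 (x := (x, t * C)) hx (y := (y, C)) hy (sub_nonneg.mpr ht1) ht0 (by ring)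
  have e : AffineMap.homothety x t y = (1 - t) • x + t • y := by
    rw [AffineMap.homothety_apply, vsub_eq_sub, vadd_eq_add]
    module
  simp only [mem_ofPred_eq, Prod.smul_mk, Prod.mk_add_mk, smul_eq_mul] at h
  rw [mem_ofPred_eq, e]
  refine h.trans (EReal.coe_le_coe_iff.mpr ?_)
  nlinarith [mul_nonneg (mul_nonneg ht0 ht0) hC]

/-- Chebyshev's inequality on a sublevel set, for a negative power of `φ`. -/
theorem rpow_neg_mul_volume_sublevel_le {n : ℕ} {p : ℝ} (hp : 0 ≤ p) {φ : En n → EReal}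
    (hφ0 : ∀ x, 0 ≤ φ x) (hφ : LowerSemicontinuous φ) (c : ℝ) :
    ENNReal.ofReal c ^ (-p) * volume {x | φ x ≤ (c : EReal)} ≤
      ∫⁻ x, posPartNN (φ x) ^ (-p) := by
  have hm : MeasurableSet {x | φ x ≤ (c : EReal)} := (hφ.isClosed_preimage c).measurableSet
  rw [← setLIntegral_const]
  refine (setLIntegral_mono' hm fun x hx => ?_).trans (setLIntegral_le_lintegral _ _)
  rw [ENNReal.rpow_neg, ENNReal.rpow_neg]
  exact ENNReal.inv_le_inv.mpr
    (ENNReal.rpow_le_rpow (posPartNN_le_ofReal (hφ0 x) hx) hp)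

/-- A convex function whose `-(n + q)`-th power is a probability density is bounded below by a
positive constant: otherwise its sublevel sets near height zero would be too large. -/
theorem exists_pos_forall_le {n : ℕ} {q : ℝ} (hq : 0 < q) {φ : En n → EReal}
    (hφ0 : ∀ x, 0 ≤ φ x) (hφ : ConvexLSC φ)
    (hρprob : ∫⁻ x, posPartNN (φ x) ^ (-((n : ℝ) + q)) = 1) :
    ∃ ε : ℝ, 0 < ε ∧ ∀ x, (ε : EReal) ≤ φ x := by
  have hp : 0 < (n : ℝ) + q := by positivity
  obtain ⟨C, hC, hA⟩ := exists_volume_sublevel_ne_zero hp (hρprob ▸ one_ne_zero)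
  obtain ⟨a, ha, haA⟩ : ∃ a : ℝ, 0 < a ∧
      ENNReal.ofReal a ≤ volume {x | φ x ≤ (C : EReal)} := by
    obtain ⟨r, hr0, hr⟩ := ENNReal.lt_iff_exists_nnreal_btwn.mp (pos_iff_ne_zero.mpr hA)
    exact ⟨r, by exact_mod_cast hr0, by simpa using hr.le⟩
  set K : ℝ := (2 * C) ^ (-((n : ℝ) + q)) * a with hK
  have hKpos : 0 < K := by positivity
  obtain ⟨t, ht0, ht1, htK⟩ : ∃ t : ℝ, 0 < t ∧ t ≤ 1 ∧ t ^ q < K := by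
    refine ⟨min 1 ((K / 2) ^ (1 / q)), by positivity, min_le_left _ _, ?_⟩
    calc (min 1 ((K / 2) ^ (1 / q))) ^ q ≤ ((K / 2) ^ (1 / q)) ^ q :=
          Real.rpow_le_rpow (by positivity) (min_le_right _ _) hq.le
      _ = K / 2 := by
          rw [← Real.rpow_mul (by positivity), one_div_mul_cancel hq.ne', Real.rpow_one]
      _ < K := by linarith
  refine ⟨t * C, by positivity, fun x => ?_⟩
  by_contra! hx
  have hvol := measure_mono (μ := volume)
    (homothety_image_sublevel_subset hφ hC.le ht0.le ht1 hx.le)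
  rw [Measure.addHaar_image_homothety, finrank_euclideanSpace, Fintype.card_fin,
    abs_of_pos (by positivity)] at hvol
  have hle : ENNReal.ofReal (2 * t * C) ^ (-((n : ℝ) + q)) *
      (ENNReal.ofReal (t ^ n) * ENNReal.ofReal a) ≤ 1 := by
    rw [← hρprob]
    refine le_trans ?_ (rpow_neg_mul_volume_sublevel_le hp.le hφ0 hφ.1 (2 * t * C))
    gcongr
    exact (mul_le_mul_right haA _).trans hvol
  rw [ENNReal.ofReal_rpow_of_pos (by positivity), ← ENNReal.ofReal_mul (by positivity),
    ← ENNReal.ofReal_mul (by positivity), ENNReal.ofReal_le_one] at hle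
  have hval : (2 * t * C) ^ (-((n : ℝ) + q)) * (t ^ n * a) = K / t ^ q := by
    rw [hK, show 2 * t * C = 2 * C * t by ring, Real.mul_rpow (by positivity) ht0.le,
      Real.rpow_neg ht0.le, Real.rpow_add ht0, Real.rpow_natCast]
    field_simp
  rw [hval, div_le_one (by positivity)] at hle
  exact hle.not_gt htK

/-- If `φ^{-(n+q)}` is a probability density with `φ` convex,
l.s.c. and nonnegative, then `φ` is bounded below by a positive constant; in
particular `φ > 0` everywhere and the density `φ^{-(n+q)}` is bounded. -/
theorem qMomentMeasures_density_bounded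
    (n : ℕ) (hn : 1 ≤ n) (q : ℝ) (hq : 0 < q)
    (φ : En n → EReal) (hφ0 : ∀ x, 0 ≤ φ x) (hφ : ConvexLSC φ)
    (hρprob : ∫⁻ x, posPartNN (φ x) ^ (-((n : ℝ) + q)) ∂(volume : Measure (En n)) = 1) :
    ∃ ε : ℝ, 0 < ε ∧ (∀ x, (ε : EReal) ≤ φ x) ∧ (∀ x, 0 < φ x) ∧
      ∃ M : ℝ≥0∞, M ≠ ⊤ ∧ ∀ x, posPartNN (φ x) ^ (-((n : ℝ) + q)) ≤ M := by
  obtain ⟨ε, hε, hle⟩ := exists_pos_forall_le hq hφ0 hφ hρprob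
  refine ⟨ε, hε, hle, fun x => (EReal.coe_pos.mpr hε).trans_le (hle x),
    ENNReal.ofReal ε ^ (-((n : ℝ) + q)), ?_, fun x => ?_⟩
  · rw [ENNReal.ofReal_rpow_of_pos hε]
    exact ENNReal.ofReal_ne_top
  · rw [ENNReal.rpow_neg, ENNReal.rpow_neg]
    exact ENNReal.inv_le_inv.mpr
      (ENNReal.rpow_le_rpow (ofReal_le_posPartNN (hle x)) (by positivity))

end
end
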